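/- There exists C > 0 such that Spreader has a winning strategy in the containment game on Z_eighth against Container of strength q = 1, with initial occupied set {(0,0)} and spreading function g(t) = ⌈C·t^{6/7}⌉; in particular 1 ∉ q(Z_eighth, t ↦ ⌈C·t^{6/7}⌉). -/

import Mathlib

open Set

/-- The number of vertices Container of strength `q` may delete at turn `t`:
`⌊t·q⌋ − ⌊(t−1)·q⌋`. -/
noncomputable def budget (q : ℝ) (t : ℕ) : ℕ :=
  (⌊(t : ℝ) * q⌋ - ⌊((t : ℝ) - 1) * q⌋).toNat

/-- The cumulative deleted sets determined by a Container strategy `σ`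
(mapping the history `[B 0, …, B t]` of occupied sets to the set of vertices deleted
at turn `t + 1`) against the occupied sets `B`. -/
def delSets {V : Type*} (σ : List (Set V) → Set V) (B : ℕ → Set V) : ℕ → Set V
  | 0 => ∅
  | t + 1 => delSets σ B t ∪ σ ((List.range (t + 1)).map B)

/-- Spreader's moves are legal with spread function `g` against cumulative deleted
sets `F`: occupied sets increase, at most `g (t + 1)` vertices are newly occupied at
turn `t + 1`, and each newly occupied vertex is undeleted and adjacent (with respect
to `adj`) to a previously occupied vertex. -/
def SpreaderLegal {V : Type*} (adj : V → V → Prop) (g : ℕ → ℕ∞)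
    (F B : ℕ → Set V) : Prop :=
  ∀ t : ℕ,
    B t ⊆ B (t + 1) ∧
    (B (t + 1) \ B t).encard ≤ g (t + 1) ∧
    ∀ v ∈ B (t + 1) \ B t, v ∉ F (t + 1) ∧ ∃ u ∈ B t, adj u v

/-- The Container strategy `σ` plays legally along occupied sets `B`: at every turn it
deletes only unoccupied vertices, and at most the budget of them. -/
def ContainerLegal {V : Type*} (q : ℝ) (σ : List (Set V) → Set V)
    (B : ℕ → Set V) : Prop :=
  ∀ t : ℕ,
    σ ((List.range (t + 1)).map B) ∩ B t = ∅ ∧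
    (σ ((List.range (t + 1)).map B)).encard ≤ (budget q (t + 1) : ℕ∞)

/-- Container of strength `q` wins the containment game on the graph `adj` with spread
function `g` and initial occupied set `B₀`, deleting only vertices of `A`: it has a
strategy which, against every legal Spreader play, is itself legal, deletes only
vertices of `A`, and forces the occupied set to eventually stabilize. -/
def ContainerWinsIn {V : Type*} (adj : V → V → Prop) (q : ℝ) (g : ℕ → ℕ∞)
    (B₀ : Set V) (A : Set V) : Prop :=
  ∃ σ : List (Set V) → Set V,
    ∀ B : ℕ → Set V, B 0 = B₀ → SpreaderLegal adj g (delSets σ B) B →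
      ContainerLegal q σ B ∧
      (∀ t : ℕ, σ ((List.range (t + 1)).map B) ⊆ A) ∧
      ∃ T : ℕ, ∀ t : ℕ, T ≤ t → B t = B T

/-- Container of strength `q` wins the containment game `(adj, q, g)` with initial
occupied set `B₀`. -/
def ContainerWins {V : Type*} (adj : V → V → Prop) (q : ℝ) (g : ℕ → ℕ∞)
    (B₀ : Set V) : Prop :=
  ContainerWinsIn adj q g B₀ Set.univ

/-- `q(G, g)`: the set of strengths `q > 0` for which Container wins the containment
game `(adj, q, g)` from every finite initial occupied set. -/
def qSet {V : Type*} (adj : V → V → Prop) (g : ℕ → ℕ∞) : Set ℝ :=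
  {q | 0 < q ∧ ∀ B₀ : Set V, B₀.Finite → ContainerWins adj q g B₀}

/-- The occupied sets determined by a Spreader strategy `τ` (mapping the history
`[F 1, …, F (t + 1)]` of cumulative deleted sets to the set of vertices newly occupied
at turn `t + 1`) against deleted sets `F`, starting from `B₀`. -/
def occSets {V : Type*} (τ : List (Set V) → Set V) (B₀ : Set V)
    (F : ℕ → Set V) : ℕ → Set V
  | 0 => B₀
  | t + 1 => occSets τ B₀ F t ∪ τ ((List.range (t + 1)).map fun i => F (i + 1))

/-- The sequence `F` of cumulative deleted sets is a legal play of Container of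
strength `q` against occupied sets `B`. -/
def ContainerSeqLegal {V : Type*} (q : ℝ) (F B : ℕ → Set V) : Prop :=
  F 0 = ∅ ∧ ∀ t : ℕ,
    F t ⊆ F (t + 1) ∧
    (F (t + 1) \ F t).encard ≤ (budget q (t + 1) : ℕ∞) ∧
    (F (t + 1) \ F t) ∩ B t = ∅

/-- Spreader wins the containment game `(adj, q, g)` with initial occupied set `B₀`:
it has a strategy which, against every legal Container play, is itself legal and
occupies new vertices at arbitrarily late times. -/
def SpreaderWins {V : Type*} (adj : V → V → Prop) (q : ℝ) (g : ℕ → ℕ∞)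
    (B₀ : Set V) : Prop :=
  ∃ τ : List (Set V) → Set V,
    ∀ F : ℕ → Set V, ContainerSeqLegal q F (occSets τ B₀ F) →
      SpreaderLegal adj g F (occSets τ B₀ F) ∧
      ∀ T : ℕ, ∃ t : ℕ, T ≤ t ∧ occSets τ B₀ F t ≠ occSets τ B₀ F T

/-- The strongly connected grid `ℤ ⊠ ℤ`. -/
def adjStrong (p q : ℤ × ℤ) : Prop :=
  max |p.1 - q.1| |p.2 - q.2| = 1

/-- The vertices of the eighth plane: `{(x, y) ∈ ℤ² : 0 ≤ x ≤ y}`. -/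
abbrev ZEighth : Type := {p : ℤ × ℤ // 0 ≤ p.1 ∧ p.1 ≤ p.2}

/-- The edges of the eighth plane: `(x, y) ~ (x + i, y + 1)` for `i ∈ {0, 1}`. -/
def adjEighth (p q : ZEighth) : Prop :=
  (q.val.2 = p.val.2 + 1 ∧ (q.val.1 = p.val.1 ∨ q.val.1 = p.val.1 + 1)) ∨
  (p.val.2 = q.val.2 + 1 ∧ (p.val.1 = q.val.1 ∨ p.val.1 = q.val.1 + 1))

namespace EP

def Nx (s : Finset ℤ) : Finset ℤ := s ∪ s.image (· + 1)

theorem mem_Nx {s : Finset ℤ} {x : ℤ} : x ∈ Nx s ↔ x ∈ s ∨ x - 1 ∈ s := by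
  unfold Nx
  simp only [Finset.mem_union, Finset.mem_image]
  constructor
  · rintro (h | ⟨a, ha, rfl⟩)
    · exact Or.inl h
    · right; simpa using ha
  · rintro (h | h)
    · exact Or.inl h
    · exact Or.inr ⟨x - 1, h, by ring⟩

theorem Nx_mono {s t : Finset ℤ} (h : s ⊆ t) : Nx s ⊆ Nx t := by
  intro x hx
  rw [mem_Nx] at *
  exact hx.imp (fun a => h a) (fun a => h a)

theorem Nx_empty : Nx ∅ = ∅ := by
  ext x; simp [mem_Nx]

theorem card_Nx {s : Finset ℤ} (hs : s.Nonempty) : s.card + 1 ≤ (Nx s).card := by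
  have hm := s.max'_mem hs
  have h1 : s.max' hs + 1 ∉ s := by
    intro h
    have := s.le_max' _ h
    omega
  have : insert (s.max' hs + 1) s ⊆ Nx s := by
    intro x hx
    rw [Finset.mem_insert] at hx
    rw [mem_Nx]
    rcases hx with rfl | hx
    · right; simpa using hm
    · exact Or.inl hx
  have := Finset.card_le_card this
  rwa [Finset.card_insert_of_notMem h1] at this

theorem card_Nx_gap {s : Finset ℤ} {a u b : ℤ} (ha : a ∈ s) (hb : b ∈ s) (hu : u ∉ s)
    (h1 : a < u) (h2 : u < b) : s.card + 2 ≤ (Nx s).card := by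
  have hne : s.Nonempty := ⟨a, ha⟩
  have hm := s.max'_mem hne
  have hmb := s.le_max' _ hb
  have hmx : s.max' hne + 1 ∉ s := by
    intro h
    have := s.le_max' _ h
    omega
  set s' := s.filter (· < u) with hs'
  have hne' : s'.Nonempty := ⟨a, by simp [hs', ha, h1]⟩
  have hm' := s'.max'_mem hne'
  have hm'' : s'.max' hne' ∈ s ∧ s'.max' hne' < u := by
    simpa [hs'] using hm'
  have hn' : s'.max' hne' + 1 ∉ s := by
    intro h
    by_cases hlt : s'.max' hne' + 1 < u
    · have := s'.le_max' (s'.max' hne' + 1) (Finset.mem_filter.2 ⟨h, hlt⟩)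
      omega
    · have : s'.max' hne' + 1 = u := by omega
      rw [this] at h
      exact hu h
  have : insert (s'.max' hne' + 1) (insert (s.max' hne + 1) s) ⊆ Nx s := by
    intro x hx
    simp only [Finset.mem_insert] at hx
    rw [mem_Nx]
    rcases hx with rfl | rfl | hx
    · right; simpa using hm''.1
    · right; simpa using hm
    · exact Or.inl hx
  have := Finset.card_le_card this
  rw [Finset.card_insert_of_notMem, Finset.card_insert_of_notMem hmx] at this
  · omega
  · rw [Finset.mem_insert]
    rintro (h | h)
    · omega
    · exact hn' h

def bd (W F : ℕ → Finset ℤ) (i : ℕ) : Finset ℤ := (Nx (W i) \ W (i + 1)) \ F (i + 1)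

def cnt (W F : ℕ → Finset ℤ) (j : ℕ) : ℕ := ∑ i ∈ Finset.range j, (bd W F i).card

theorem mem_bd {W F : ℕ → Finset ℤ} {i : ℕ} {x : ℤ} :
    x ∈ bd W F i ↔ (x ∈ W i ∨ x - 1 ∈ W i) ∧ x ∉ W (i + 1) ∧ x ∉ F (i + 1) := by
  unfold bd
  rw [Finset.mem_sdiff, Finset.mem_sdiff, mem_Nx, and_assoc]

theorem cnt_succ (W F : ℕ → Finset ℤ) (j : ℕ) : cnt W F (j + 1) = cnt W F j + (bd W F j).card :=
  Finset.sum_range_succ _ _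

theorem cnt_zero (W F : ℕ → Finset ℤ) : cnt W F 0 = 0 := rfl

theorem cnt_mono (W F : ℕ → Finset ℤ) : Monotone (cnt W F) :=
  monotone_nat_of_le_succ (fun n => by rw [cnt_succ]; omega)

/-- paths moving by 0 or 1 each level -/
def IsPath (p : ℕ → ℤ) : Prop := ∀ i, p (i + 1) = p i ∨ p (i + 1) = p i + 1

theorem IsPath.mono {p : ℕ → ℤ} (h : IsPath p) (i : ℕ) : p 0 ≤ p i ∧ p i ≤ p 0 + i := by
  induction i with
  | zero => simp
  | succ n ih => rcases h n with h | h <;> (push_cast; omega)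

theorem IsPath.min {p q : ℕ → ℤ} (hp : IsPath p) (hq : IsPath q) :
    IsPath (fun i => min (p i) (q i)) := by
  intro i
  have := hp i
  have := hq i
  dsimp only
  omega

theorem IsPath.max {p q : ℕ → ℤ} (hp : IsPath p) (hq : IsPath q) :
    IsPath (fun i => max (p i) (q i)) := by
  intro i
  have := hp i
  have := hq i
  dsimp only
  omega

/-- glue: path through x at level e, then constant -/
theorem path_extend {p : ℕ → ℤ} (hp : IsPath p) (e : ℕ) (x : ℤ) (hx : x = p e ∨ x = p e + 1) :
    ∃ q, IsPath q ∧ (∀ i ≤ e, q i = p i) ∧ q (e + 1) = x := by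
  refine ⟨fun i => if i ≤ e then p i else x, ?_, ?_, ?_⟩
  · intro i
    dsimp only
    by_cases h : i + 1 ≤ e
    · rw [if_pos h, if_pos (by omega)]; exact hp i
    · rw [if_neg h]
      by_cases h2 : i ≤ e
      · rw [if_pos h2]
        have : i = e := by omega
        subst this; exact hx
      · rw [if_neg h2]; simp
  · intro i hi; simp [hi]
  · simp

/-- glue below: replace the values at levels ≤ t. -/
theorem path_prepend {p : ℕ → ℤ} (hp : IsPath p) (t : ℕ) (y : ℤ)
    (hy : p (t + 1) = y ∨ p (t + 1) = y + 1) :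
    ∃ q, IsPath q ∧ (∀ i, t + 1 ≤ i → q i = p i) ∧ q t = y := by
  refine ⟨fun i => if i ≤ t then y else p i, ?_, ?_, ?_⟩
  · intro i
    dsimp only
    by_cases h : i + 1 ≤ t
    · rw [if_pos h, if_pos (by omega)]; simp
    · rw [if_neg h]
      by_cases h2 : i ≤ t
      · rw [if_pos h2]
        have : i = t := by omega
        subst this; exact hy
      · rw [if_neg h2]; exact hp i
  · intro i hi; exact if_neg (by omega)
  · simp

/-- reachable within W from B -/
def up (W : ℕ → Finset ℤ) (B : Finset ℤ) : ℕ → Finset ℤ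
  | 0 => B
  | j + 1 => Nx (up W B j) ∩ W (j + 1)

theorem up_path {W : ℕ → Finset ℤ} {B : Finset ℤ} (j : ℕ) : ∀ x ∈ up W B j,
    ∃ p, IsPath p ∧ p j = x ∧ p 0 ∈ B ∧ ∀ i, 1 ≤ i → i ≤ j → p i ∈ W i := by
  induction j with
  | zero => 
    intro x hx
    exact ⟨fun _ => x, fun i => Or.inl rfl, rfl, hx, fun i h1 h2 => by omega⟩
  | succ n ih =>
    intro x hx
    rw [up, Finset.mem_inter, mem_Nx] at hx
    obtain ⟨hx1, hx2⟩ := hx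
    have : ∃ y ∈ up W B n, x = y ∨ x = y + 1 := by
      rcases hx1 with h | h
      · exact ⟨x, h, Or.inl rfl⟩
      · exact ⟨x - 1, h, Or.inr (by ring)⟩
    obtain ⟨y, hy, hxy⟩ := this
    obtain ⟨p, hp, hpn, hp0, hpW⟩ := ih y hy
    obtain ⟨q, hq, hqe, hqx⟩ := path_extend hp n x (by rw [hpn]; exact hxy)
    refine ⟨q, hq, hqx, by rw [hqe 0 (by omega)]; exact hp0, ?_⟩
    intro i h1 h2
    by_cases h : i ≤ n
    · rw [hqe i h]; exact hpW i h1 h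
    · have : i = n + 1 := by omega
      subst this; rw [hqx]; exact hx2

theorem path_up {W : ℕ → Finset ℤ} {B : Finset ℤ} {p : ℕ → ℤ} (hp : IsPath p) (j : ℕ)
    (h0 : p 0 ∈ B) (h : ∀ i, 1 ≤ i → i ≤ j → p i ∈ W i) : p j ∈ up W B j := by
  induction j with
  | zero => exact h0
  | succ n ih =>
    rw [up, Finset.mem_inter, mem_Nx]
    have := ih (fun i h1 h2 => h i h1 (by omega))
    refine ⟨?_, h _ (by omega) le_rfl⟩
    rcases hp n with e | e
    · left; rwa [e]
    · right; rw [e]; simpa using this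

def rch (F : ℕ → Finset ℤ) (B : Finset ℤ) : ℕ → Finset ℤ
  | 0 => B
  | j + 1 => Nx (rch F B j) \ F (j + 1)

theorem rch_mono {F : ℕ → Finset ℤ} {A B : Finset ℤ} (h : A ⊆ B) (j : ℕ) :
    rch F A j ⊆ rch F B j := by
  induction j with
  | zero => exact h
  | succ n ih => exact Finset.sdiff_subset_sdiff (Nx_mono ih) (Finset.Subset.refl _)

theorem sub4 {X Y A B : Finset ℤ} (h1 : X ∪ Y ⊆ A ∪ B) (h2 : X ∩ Y ⊆ A ∩ B) :
    X.card + Y.card ≤ A.card + B.card := by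
  rw [← Finset.card_union_add_card_inter X Y, ← Finset.card_union_add_card_inter A B]
  exact Nat.add_le_add (Finset.card_le_card h1) (Finset.card_le_card h2)

end EP

namespace EP

/-- fill lemma -/
theorem fill_child {m M : ℕ → ℤ} (hm : IsPath m) (hM : IsPath M) {W : ℕ → Finset ℤ} {i : ℕ}
    (h1 : m i ∈ W i) (h2 : M i ∈ W i) {z x : ℤ} (hz : z ∈ Finset.Icc (m i) (M i))
    (hzW : z ∉ W i) (hx : x = z ∨ x = z + 1) : x ∈ Finset.Icc (m (i + 1)) (M (i + 1)) := by
  rw [Finset.mem_Icc] at *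
  have : z ≠ m i := by rintro rfl; exact hzW h1
  have : z ≠ M i := by rintro rfl; exact hzW h2
  have := hm i
  have := hM i
  omega

/-- fill up to level k -/
noncomputable def fil (W : ℕ → Finset ℤ) (m M : ℕ → ℤ) (k : ℕ) : ℕ → Finset ℤ :=
  fun i => if i < k then W i ∪ Finset.Icc (m i) (M i) else W i

theorem fil_bd {W F : ℕ → Finset ℤ} {m M : ℕ → ℤ} (hm : IsPath m) (hM : IsPath M) {k : ℕ}
    (h1 : ∀ i ≤ k, m i ∈ W i) (h2 : ∀ i ≤ k, M i ∈ W i) (i : ℕ) {x : ℤ}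
    (hx : x ∈ bd (fil W m M k) F i) :
    (x ∈ bd W F i ∧ (i + 1 < k → x ∉ Finset.Icc (m (i + 1)) (M (i + 1)))) ∨
      (i + 1 = k ∧ x ∈ Finset.Icc (m k) (M k) \ W k) := by
  rw [mem_bd] at hx
  obtain ⟨hp, hW, hF⟩ := hx
  have hW' : x ∉ W (i + 1) := by
    intro h; apply hW; unfold fil; split_ifs <;> simp [h]
  have hI : i + 1 < k → x ∉ Finset.Icc (m (i + 1)) (M (i + 1)) := by
    intro hk h; apply hW; unfold fil; rw [if_pos hk]; exact Finset.mem_union_right _ h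
  have hpar : ∃ z ∈ fil W m M k i, x = z ∨ x = z + 1 := by
    rcases hp with h | h
    · exact ⟨_, h, Or.inl rfl⟩
    · exact ⟨_, h, Or.inr (by ring)⟩
  obtain ⟨z, hz, hxz⟩ := hpar
  by_cases hzW : z ∈ W i
  · left
    refine ⟨mem_bd.2 ⟨?_, hW', hF⟩, hI⟩
    rcases hxz with rfl | rfl
    · exact Or.inl hzW
    · right; simpa using hzW
  · unfold fil at hz
    split_ifs at hz with hk
    · have hz' : z ∈ Finset.Icc (m i) (M i) := by
        rcases Finset.mem_union.1 hz with h | h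
        · exact absurd h hzW
        · exact h
      have := fill_child hm hM (h1 i hk.le) (h2 i hk.le) hz' hzW hxz
      right
      have hk' : i + 1 = k := by
        by_contra hne
        exact hI (by omega) this
      subst hk'
      exact ⟨rfl, Finset.mem_sdiff.2 ⟨this, hW'⟩⟩
    · exact absurd hz hzW

theorem cnt_le_of_bd {W Y F : ℕ → Finset ℤ} (h : ∀ i, bd Y F i ⊆ bd W F i) (j : ℕ) :
    cnt Y F j ≤ cnt W F j :=
  Finset.sum_le_sum (fun i _ => Finset.card_le_card (h i))

/-- cone paths in clean area -/
theorem cone_path {W F : ℕ → Finset ℤ} {h : ℕ} {l : ℤ} (hl : l ∈ W 0)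
    (hcl : ∀ j, 1 ≤ j → j ≤ h → ∀ x, l ≤ x → x ≤ l + j → x ∉ F j)
    (hc : ∀ j ≤ h, cnt W F j ≤ j) :
    ∃ p, IsPath p ∧ p 0 = l ∧ ∀ i ≤ h, p i ∈ W i := by
  have hr : ∀ j, ∀ x ∈ up W {l} j, l ≤ x ∧ x ≤ l + j := by
    intro j x hx
    obtain ⟨p, hp, hpj, hp0, -⟩ := up_path j x hx
    rw [Finset.mem_singleton] at hp0
    have := hp.mono j
    omega
  have hW : ∀ j, up W {l} j ⊆ W j := by
    intro j
    cases j with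
    | zero => simpa [up] using hl
    | succ n => exact Finset.inter_subset_right
  have key : ∀ j ≤ h, 1 + j ≤ (up W {l} j).card + cnt W F j := by
    intro j
    induction j with
    | zero => intro _; simp [up]
    | succ n ih =>
      intro hn
      have ih := ih (by omega)
      have hcn := hc n (by omega)
      have hne : (up W {l} n).Nonempty := by
        rw [← Finset.card_pos]; omega
      have h1 := card_Nx hne
      have h2 : Nx (up W {l} n) ⊆ up W {l} (n + 1) ∪ bd W F n := by
        intro x hx
        rw [Finset.mem_union]
        by_cases hxW : x ∈ W (n + 1)
        · left; rw [up, Finset.mem_inter]; exact ⟨hx, hxW⟩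
        · right
          rw [mem_bd]
          rw [mem_Nx] at hx
          refine ⟨hx.imp (fun a => hW n a) (fun a => hW n a), hxW, ?_⟩
          apply hcl (n + 1) (by omega) hn
          · rcases hx with hx | hx <;> have := hr n _ hx <;> omega
          · rcases hx with hx | hx <;> have := hr n _ hx <;> push_cast <;> omega
      have h3 := Finset.card_le_card h2
      have h4 := Finset.card_union_le (up W {l} (n + 1)) (bd W F n)
      rw [cnt_succ]
      omega
  have hne : (up W {l} h).Nonempty := by
    rw [← Finset.card_pos]
    have := key h le_rfl
    have := hc h le_rfl
    omega
  obtain ⟨x, hx⟩ := hne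
  obtain ⟨p, hp, hpj, hp0, hpW⟩ := up_path h x hx
  rw [Finset.mem_singleton] at hp0
  refine ⟨p, hp, hp0, ?_⟩
  intro i hi
  rcases Nat.eq_zero_or_pos i with rfl | hi0
  · rw [hp0]; exact hl
  · exact hpW i hi0 hi

theorem card_shift {s D : Finset ℤ} (hs : s.Nonempty) (hD : ∀ x ∈ D, x ∈ s ∧ x - 1 ∈ s) :
    D.card + 1 ≤ s.card := by
  have hm := s.min'_mem hs
  have h1 : s.min' hs ∉ D := by
    intro h
    have := s.min'_le _ (hD _ h).2
    omega
  rw [← Finset.card_insert_of_notMem h1]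
  apply Finset.card_le_card
  intro x hx
  rcases Finset.mem_insert.1 hx with rfl | hx
  · exact hm
  · exact (hD x hx).1

theorem T1 {W F : ℕ → Finset ℤ} {h : ℕ} {l r : ℤ} (hh : 1 ≤ h) (hl : l ∈ W 0) (hr : r ∈ W 0)
    (hlr : l ≤ r) (hlr2 : r < l + h)
    (hcl : ∀ j, 1 ≤ j → j ≤ h → ∀ x, l ≤ x → x ≤ r + j → x ∉ F j)
    (hc : ∀ j ≤ h, cnt W F j ≤ j) :
    ∃ Y : ℕ → Finset ℤ, (∀ i, W i ⊆ Y i) ∧ Finset.Icc l r ⊆ Y 0 ∧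
      (∀ j, cnt Y F j ≤ cnt W F j) ∧ ∀ j, h ≤ j → Y j = W j := by
  obtain ⟨p, hp, hp0, hpW⟩ := cone_path (F := F) hl
    (fun j h1 h2 x hx1 hx2 => hcl j h1 h2 x hx1 (by omega)) hc
  obtain ⟨q, hq, hq0, hqW⟩ := cone_path (F := F) hr
    (fun j h1 h2 x hx1 hx2 => hcl j h1 h2 x (by omega) (by omega)) hc
  obtain ⟨m, hm, M, hM, hm0, hM0, hmW, hMW⟩ : ∃ m, IsPath m ∧ ∃ M, IsPath M ∧ m 0 = l ∧ M 0 = r ∧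
      (∀ i ≤ h, m i ∈ W i) ∧ (∀ i ≤ h, M i ∈ W i) := by
    refine ⟨_, hp.min hq, _, hp.max hq, by simp [hp0, hq0, hlr], by simp [hp0, hq0, hlr], ?_, ?_⟩
    · intro i hi
      rcases min_choice (p i) (q i) with e | e <;> rw [e]
      · exact hpW i hi
      · exact hqW i hi
    · intro i hi
      rcases max_choice (p i) (q i) with e | e <;> rw [e]
      · exact hpW i hi
      · exact hqW i hi
  have hsub : ∀ k i, W i ⊆ fil W m M k i := by
    intro k i
    unfold fil
    split_ifs
    · exact Finset.subset_union_left
    · exact Finset.Subset.refl _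
  by_cases hex : ∃ k ≤ h, Finset.Icc (m k) (M k) \ W k = ∅
  · obtain ⟨k, hk, hke⟩ := hex
    refine ⟨fil W m M k, hsub k, ?_, ?_, ?_⟩
    · unfold fil
      split_ifs with h0
      · rw [hm0, hM0]; exact Finset.subset_union_right
      · have : k = 0 := by omega
        subst this
        rw [hm0, hM0, Finset.sdiff_eq_empty_iff_subset] at hke
        exact hke
    · apply cnt_le_of_bd
      intro i x hx
      rcases fil_bd hm hM (fun i hi => hmW i (by omega)) (fun i hi => hMW i (by omega)) i hx with h | h
      · exact h.1
      · rw [hke] at h; simp at h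
    · intro j hj
      unfold fil
      rw [if_neg (by omega)]
  · push Not at hex
    have hF : ∀ i, 1 ≤ i → i ≤ h → ∀ x ∈ Finset.Icc (m i) (M i), x ∉ F i := by
      intro i h1 h2 x hx
      rw [Finset.mem_Icc] at hx
      have := hm.mono i
      have := hM.mono i
      exact hcl i h1 h2 x (by omega) (by omega)
    set c : ℕ → ℕ := fun i => (bd W F i ∩ Finset.Icc (m (i + 1)) (M (i + 1))).card with hcdef
    have key : ∀ j ≤ h, (Finset.Icc (m j) (M j) \ W j).card + j + 1 ≤ 
        h + ∑ i ∈ Finset.range j, c i := by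
      intro j
      induction j with
      | zero =>
        intro _
        have h1 : Finset.Icc (m 0) (M 0) \ W 0 ⊆ (Finset.Icc l r).erase l := by
          intro x hx
          rw [Finset.mem_sdiff, hm0, hM0] at hx
          rw [Finset.mem_erase]
          exact ⟨fun e => hx.2 (e ▸ hl), hx.1⟩
        have h2 := Finset.card_le_card h1
        rw [Finset.card_erase_of_mem (by simp [hlr]), Int.card_Icc] at h2
        simp only [Finset.range_zero, Finset.sum_empty]
        omega
      | succ n ih =>
        intro hn
        have ih := ih (by omega)
        have hne := hex n (by omega)
        have h1 := card_shift (D := (Finset.Icc (m (n+1)) (M (n+1)) \ W (n+1)) \ bd W F n) hne (by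
          intro x hx
          rw [Finset.mem_sdiff, Finset.mem_sdiff] at hx
          obtain ⟨⟨hxI, hxW⟩, hxb⟩ := hx
          have hxF := hF (n+1) (by omega) hn x hxI
          have hpar : ¬ (x ∈ W n ∨ x - 1 ∈ W n) := fun h => hxb (mem_bd.2 ⟨h, hxW, hxF⟩)
          push Not at hpar
          simp only [Finset.mem_sdiff, Finset.mem_Icc] at hxI ⊢
          have e1 : x ≠ m (n+1) := by rintro rfl; exact hxW (hmW _ hn)
          have e2 : x ≠ M (n+1) := by rintro rfl; exact hxW (hMW _ hn)
          have e3 : x ≠ m n := by rintro rfl; exact hpar.1 (hmW _ (by omega))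
          have e4 : x ≠ M n := by rintro rfl; exact hpar.1 (hMW _ (by omega))
          have := hm n
          have := hM n
          refine ⟨⟨⟨by omega, by omega⟩, hpar.1⟩, ⟨⟨by omega, by omega⟩, hpar.2⟩⟩)
        have h2 : Finset.Icc (m (n+1)) (M (n+1)) \ W (n+1) ⊆
            ((Finset.Icc (m (n+1)) (M (n+1)) \ W (n+1)) \ bd W F n) ∪ 
              (bd W F n ∩ Finset.Icc (m (n + 1)) (M (n + 1))) := by
          intro x hx
          by_cases hxb : x ∈ bd W F n
          · apply Finset.mem_union_right
            exact Finset.mem_inter.2 ⟨hxb, (Finset.mem_sdiff.1 hx).1⟩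
          · apply Finset.mem_union_left
            exact Finset.mem_sdiff.2 ⟨hx, hxb⟩
        have h3 := (Finset.card_le_card h2).trans (Finset.card_union_le _ _)
        rw [Finset.sum_range_succ]
        have : c n = (bd W F n ∩ Finset.Icc (m (n + 1)) (M (n + 1))).card := rfl
        omega
    refine ⟨fil W m M h, hsub h, ?_, ?_, ?_⟩
    · unfold fil
      rw [if_pos (by omega), hm0, hM0]; exact Finset.subset_union_right
    · have hlt : ∀ i, i + 1 < h → (bd (fil W m M h) F i).card + c i ≤ (bd W F i).card := by
        intro i hi
        have h1 : bd (fil W m M h) F i ⊆ bd W F i \ Finset.Icc (m (i + 1)) (M (i + 1)) := by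
          intro x hx
          rcases fil_bd hm hM hmW hMW i hx with h | h
          · exact Finset.mem_sdiff.2 ⟨h.1, h.2 hi⟩
          · omega
        have h2 := Finset.card_le_card h1
        have h3 := Finset.card_sdiff_add_card_inter (bd W F i) (Finset.Icc (m (i + 1)) (M (i + 1)))
        have : c i = (bd W F i ∩ Finset.Icc (m (i + 1)) (M (i + 1))).card := rfl
        omega
      have heq : ∀ i, h ≤ i → bd (fil W m M h) F i ⊆ bd W F i := by
        intro i hi x hx
        rcases fil_bd hm hM hmW hMW i hx with h | h
        · exact h.1
        · omega
      obtain ⟨h', rfl⟩ : ∃ h', h = h' + 1 := ⟨h - 1, by omega⟩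
      have hsum : ∀ j ≤ h', cnt (fil W m M (h' + 1)) F j + ∑ i ∈ Finset.range j, c i ≤ cnt W F j := by
        intro j hj
        unfold cnt
        rw [← Finset.sum_add_distrib]
        apply Finset.sum_le_sum
        intro i hi
        exact hlt i (by have := Finset.mem_range.1 hi; omega)
      have hfin : cnt (fil W m M (h' + 1)) F (h' + 1) ≤ cnt W F (h' + 1) := by
        have h1 := hsum h' le_rfl
        have h2 := key (h' + 1) le_rfl
        rw [Finset.sum_range_succ] at h2
        rw [cnt_succ, cnt_succ]
        have h3 : bd (fil W m M (h' + 1)) F h' ⊆ 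
          (bd W F h' \ Finset.Icc (m (h' + 1)) (M (h' + 1))) ∪ (Finset.Icc (m (h' + 1)) (M (h' + 1)) \ W (h'+1)) := by
          intro x hx
          rw [Finset.mem_union]
          have hxW : x ∉ W (h' + 1) := by
            have := (mem_bd.1 hx).2.1
            intro h
            exact this (hsub _ _ h)
          rcases fil_bd hm hM hmW hMW h' hx with h | h
          · by_cases hxI : x ∈ Finset.Icc (m (h' + 1)) (M (h' + 1))
            · right; exact Finset.mem_sdiff.2 ⟨hxI, hxW⟩
            · left; exact Finset.mem_sdiff.2 ⟨h.1, hxI⟩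
          · exact Or.inr h.2
        have h4 := (Finset.card_le_card h3).trans (Finset.card_union_le _ _)
        have h5 := Finset.card_sdiff_add_card_inter (bd W F h') (Finset.Icc (m (h' + 1)) (M (h' + 1)))
        have : c h' = (bd W F h' ∩ Finset.Icc (m (h' + 1)) (M (h' + 1))).card := rfl
        omega
      intro j
      rcases Nat.lt_or_ge j (h' + 1) with hj | hj
      · have := hsum j (by omega)
        omega
      · induction j, hj using Nat.le_induction with
        | base => exact hfin
        | succ n hn ih =>
          rw [cnt_succ, cnt_succ]
          have := Finset.card_le_card (heq n hn)
          omega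
    · intro j hj
      unfold fil
      rw [if_neg (by omega)]

/-- good frame -/
theorem good_frame {W F : ℕ → Finset ℤ} {h : ℕ} (hh : 1 ≤ h) (S A : Finset ℤ) (hS : S ⊆ W 0)
    (hA : ∀ a ∈ A, a ∈ S ∨ ∃ l ∈ S, ∃ r ∈ S, l ≤ a ∧ a ≤ r ∧ r < l + h ∧
      ∀ j, 1 ≤ j → j ≤ h → ∀ x, l ≤ x → x ≤ r + j → x ∉ F j)
    (hc : ∀ j ≤ h, cnt W F j ≤ j) :
    ∃ Y : ℕ → Finset ℤ, (∀ i, W i ⊆ Y i) ∧ A ⊆ Y 0 ∧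
      (∀ j, cnt Y F j ≤ cnt W F j) ∧ ∀ j, h ≤ j → Y j = W j := by
  induction A using Finset.induction_on with
  | empty => exact ⟨W, fun i => Finset.Subset.refl _, by simp, fun j => le_rfl, fun j _ => rfl⟩
  | insert a A _ ih =>
    obtain ⟨Y, h1, h2, h3, h4⟩ := ih (fun b hb => hA b (Finset.mem_insert_of_mem hb))
    rcases hA a (Finset.mem_insert_self _ _) with ha | ⟨l, hl, r, hr, hla, har, hlr, hcl⟩
    · refine ⟨Y, h1, ?_, h3, h4⟩
      rw [Finset.insert_subset_iff]
      exact ⟨h1 0 (hS ha), h2⟩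
    · obtain ⟨Z, g1, g2, g3, g4⟩ := T1 (W := Y) (F := F) hh (h1 0 (hS hl)) (h1 0 (hS hr)) (by omega) hlr hcl
        (fun j hj => (h3 j).trans (hc j hj))
      refine ⟨Z, fun i => (h1 i).trans (g1 i), ?_, fun j => (g3 j).trans (h3 j), 
        fun j hj => (g4 j hj).trans (h4 j hj)⟩
      rw [Finset.insert_subset_iff]
      exact ⟨g2 (Finset.mem_Icc.2 ⟨hla, har⟩), h2.trans (g1 0)⟩

end EP

namespace EP

/-- cost -/
def bcost (E : ℕ) (F : ℕ → Finset ℤ) (Q : Finset ℤ) (R : ℕ → Finset ℤ) : ℕ :=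
  (Q \ R 0).card + cnt R F E

noncomputable def lam (E : ℕ) (F : ℕ → Finset ℤ) (Q : Finset ℤ) : ℕ :=
  sInf {n | ∃ R : ℕ → Finset ℤ, R E = ∅ ∧ bcost E F Q R = n}

theorem lam_exists (E : ℕ) (F : ℕ → Finset ℤ) (Q : Finset ℤ) :
    ∃ R : ℕ → Finset ℤ, R E = ∅ ∧ bcost E F Q R = lam E F Q := by
  have : lam E F Q ∈ {n | ∃ R : ℕ → Finset ℤ, R E = ∅ ∧ bcost E F Q R = n} :=
    Nat.sInf_mem ⟨_, fun _ => ∅, rfl, rfl⟩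
  exact this

theorem lam_le {E : ℕ} {F : ℕ → Finset ℤ} {Q : Finset ℤ} {R : ℕ → Finset ℤ} (hR : R E = ∅) :
    lam E F Q ≤ bcost E F Q R := Nat.sInf_le ⟨R, hR, rfl⟩

theorem lam_mono {E : ℕ} {F : ℕ → Finset ℤ} {P Q : Finset ℤ} (h : P ⊆ Q) :
    lam E F P ≤ lam E F Q := by
  obtain ⟨R, hR, he⟩ := lam_exists E F Q
  rw [← he]
  refine (lam_le hR).trans ?_
  unfold bcost
  have := Finset.card_le_card (Finset.sdiff_subset_sdiff h (Finset.Subset.refl (R 0)))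
  omega

theorem lam_insert {E : ℕ} {F : ℕ → Finset ℤ} (a : ℤ) (Q : Finset ℤ) :
    lam E F (insert a Q) ≤ lam E F Q + 1 := by
  obtain ⟨R, hR, he⟩ := lam_exists E F Q
  rw [← he]
  refine (lam_le hR).trans ?_
  unfold bcost
  have : insert a Q \ R 0 ⊆ insert a (Q \ R 0) := by
    intro x; simp only [Finset.mem_sdiff, Finset.mem_insert]; tauto
  have := (Finset.card_le_card this).trans (Finset.card_insert_le _ _)
  omega

theorem lam_empty {E : ℕ} {F : ℕ → Finset ℤ} : lam E F ∅ = 0 := by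
  have := lam_le (E := E) (F := F) (Q := ∅) (R := fun _ => ∅) rfl
  have h : bcost E F ∅ (fun _ => ∅) = 0 := by
    simp [bcost, cnt, bd, Nx_empty]
  omega

theorem lam_submod {E : ℕ} {F : ℕ → Finset ℤ} (P Q : Finset ℤ) :
    lam E F (P ∪ Q) + lam E F (P ∩ Q) ≤ lam E F P + lam E F Q := by
  obtain ⟨R, hR, he⟩ := lam_exists E F P
  obtain ⟨T, hT, he'⟩ := lam_exists E F Q
  have h1 : lam E F (P ∪ Q) ≤ bcost E F (P ∪ Q) (fun i => R i ∪ T i) := lam_le (by simp [hR, hT])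
  have h2 : lam E F (P ∩ Q) ≤ bcost E F (P ∩ Q) (fun i => R i ∩ T i) := lam_le (by simp [hR, hT])
  rw [← he, ← he']
  unfold bcost at *
  have h3 : ((P ∪ Q) \ (R 0 ∪ T 0)).card + ((P ∩ Q) \ (R 0 ∩ T 0)).card ≤
      (P \ R 0).card + (Q \ T 0).card := by
    apply sub4 <;> intro x <;> simp only [Finset.mem_union, Finset.mem_inter, Finset.mem_sdiff] <;> tauto
  have h4 : cnt (fun i => R i ∪ T i) F E + cnt (fun i => R i ∩ T i) F E ≤ cnt R F E + cnt T F E := by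
    unfold cnt
    rw [← Finset.sum_add_distrib, ← Finset.sum_add_distrib]
    apply Finset.sum_le_sum
    intro i _
    apply sub4 <;> intro x <;>
      simp only [Finset.mem_union, Finset.mem_inter, mem_bd] <;> tauto
  dsimp only at h1 h2
  omega

theorem lam_span {E : ℕ} {F : ℕ → Finset ℤ} {G Q : Finset ℤ} (Z : Finset ℤ) (hG : G ⊆ Q)
    (h : lam E F G = lam E F Q) : lam E F (G ∪ Z) = lam E F (Q ∪ Z) := by
  apply le_antisymm (lam_mono (Finset.union_subset_union_left hG))
  have h1 := lam_submod (E := E) (F := F) Q (G ∪ Z)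
  have h2 : Q ∪ (G ∪ Z) = Q ∪ Z := by
    ext x; simp only [Finset.mem_union]; have := @hG x; tauto
  have h3 : lam E F G ≤ lam E F (Q ∩ (G ∪ Z)) := lam_mono (by
    intro x; simp only [Finset.mem_union, Finset.mem_inter]; have := @hG x; tauto)
  rw [h2] at h1
  omega

theorem lam_alive {E : ℕ} {W F : ℕ → Finset ℤ} {B : Finset ℤ} (hB : B ⊆ W 0)
    (h : up W B E = ∅) : lam E F B ≤ cnt W F E := by
  refine (lam_le h).trans ?_
  unfold bcost
  have hW : ∀ j, up W B j ⊆ W j := by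
    intro j
    cases j with
    | zero => simpa [up] using hB
    | succ n => exact Finset.inter_subset_right
  have h0 : B \ up W B 0 = ∅ := by simp [up]
  rw [h0, Finset.card_empty, Nat.zero_add]
  apply cnt_le_of_bd
  intro i x hx
  rw [mem_bd] at *
  refine ⟨hx.1.imp (fun a => hW _ a) (fun a => hW _ a), ?_, hx.2.2⟩
  intro h'
  apply hx.2.1
  rw [up, Finset.mem_inter, mem_Nx]
  exact ⟨hx.1, h'⟩

/-- greedy basis w.r.t. key -/
noncomputable def greedy (E : ℕ) (F : ℕ → Finset ℤ) (key : ℤ → ℤ) (K : ℕ) (A : Finset ℤ) : Finset ℤ :=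
  A.filter (fun a => lam E F (A.filter (fun x => key x < key a)) < lam E F (A.filter (fun x => key x ≤ key a)) ∧
    lam E F (A.filter (fun x => key x ≤ key a)) ≤ K + 1)

theorem greedy_sub {E : ℕ} {F : ℕ → Finset ℤ} {key : ℤ → ℤ} {K : ℕ} {A : Finset ℤ} :
    greedy E F key K A ⊆ A := Finset.filter_subset _ _

theorem greedy_card {E : ℕ} {F : ℕ → Finset ℤ} {key : ℤ → ℤ} (hk : Function.Injective key) {K : ℕ}
    {A : Finset ℤ} : (greedy E F key K A).card ≤ K + 1 := by
  have : (greedy E F key K A).card ≤ (Finset.Icc 1 (K + 1)).card := by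
    apply Finset.card_le_card_of_injOn (fun a => lam E F (A.filter (fun x => key x ≤ key a)))
    · intro a ha
      have ha := (Finset.mem_filter.1 ha).2
      simp only [Finset.coe_Icc, Set.mem_Icc]
      omega
    · intro a ha b hb hab
      have ha := (Finset.mem_filter.1 ha).2
      have hb := (Finset.mem_filter.1 hb).2
      dsimp only at hab
      by_contra hne
      have hne' : key a ≠ key b := fun h => hne (hk h)
      rcases lt_or_gt_of_ne hne' with h | h
      · have : lam E F (A.filter (fun x => key x ≤ key a)) ≤ lam E F (A.filter (fun x => key x < key b)) :=
          lam_mono (Finset.monotone_filter_right _ (fun x _ hx => lt_of_le_of_lt hx h))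
        omega
      · have : lam E F (A.filter (fun x => key x ≤ key b)) ≤ lam E F (A.filter (fun x => key x < key a)) :=
          lam_mono (Finset.monotone_filter_right _ (fun x _ hx => lt_of_le_of_lt hx h))
        omega
  simpa using this

/-- prefix property -/
theorem greedy_prefix {E : ℕ} {F : ℕ → Finset ℤ} {key : ℤ → ℤ} (hk : Function.Injective key) {K : ℕ}
    {A : Finset ℤ} (Q : Finset ℤ) : Q ⊆ A → (∀ a ∈ A, ∀ b ∈ Q, key a ≤ key b → a ∈ Q) →
    lam E F (greedy E F key K A ∩ Q) = lam E F Q ∨ K + 1 ≤ lam E F (greedy E F key K A ∩ Q) := by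
  induction Q using Finset.induction_on_max_value key with
  | empty => intro _ _; simp
  | insert a Q haQ hmax ih =>
    intro hQA hpre
    have haA : a ∈ A := hQA (Finset.mem_insert_self _ _)
    have hQeq : A.filter (fun x => key x < key a) = Q := by
      ext x
      rw [Finset.mem_filter]
      constructor
      · rintro ⟨hx, hlt⟩
        have := hpre x hx a (Finset.mem_insert_self _ _) hlt.le
        rcases Finset.mem_insert.1 this with rfl | h
        · exact absurd hlt (lt_irrefl _)
        · exact h
      · intro hx
        refine ⟨hQA (Finset.mem_insert_of_mem hx), lt_of_le_of_ne (hmax x hx) ?_⟩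
        intro h
        exact haQ (hk h ▸ hx)
    have hQeq' : A.filter (fun x => key x ≤ key a) = insert a Q := by
      ext x
      rw [Finset.mem_filter]
      constructor
      · rintro ⟨hx, hle⟩
        exact hpre x hx a (Finset.mem_insert_self _ _) hle
      · intro hx
        refine ⟨hQA hx, ?_⟩
        rcases Finset.mem_insert.1 hx with rfl | h
        · exact le_rfl
        · exact hmax x h
    have ih := ih (fun x hx => hQA (Finset.mem_insert_of_mem hx)) (by
      intro x hx b hb hle
      rcases Finset.mem_insert.1 (hpre x hx b (Finset.mem_insert_of_mem hb) hle) with rfl | h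
      · exact absurd (hk (le_antisymm hle (hmax b hb))) (fun h => haQ (h ▸ hb))
      · exact h)
    set G := greedy E F key K A with hG
    have hmono : lam E F (G ∩ Q) ≤ lam E F (G ∩ insert a Q) :=
      lam_mono (Finset.inter_subset_inter_left (Finset.subset_insert _ _))
    rcases ih with ih | ih
    · have hspan := lam_span {a} (Finset.inter_subset_right : G ∩ Q ⊆ Q) ih
      have e2 : Q ∪ {a} = insert a Q := by ext x; simp
      by_cases haG : a ∈ G
      · left
        have e1 : G ∩ Q ∪ {a} = G ∩ insert a Q := by
          ext x; simp only [Finset.mem_union, Finset.mem_inter, Finset.mem_insert, Finset.mem_singleton]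
          by_cases hxa : x = a
          · subst hxa; simp [haG]
          · simp [hxa]
        rw [← e1, ← e2]; exact hspan
      · have h1 := lam_mono (E := E) (F := F) (Finset.subset_insert a Q)
        have h2 := lam_insert (E := E) (F := F) a Q
        have h3 : ¬ (lam E F Q < lam E F (insert a Q) ∧ lam E F (insert a Q) ≤ K + 1) := by
          intro h
          apply haG
          rw [hG, greedy, Finset.mem_filter, hQeq, hQeq']
          exact ⟨haA, h⟩
        have h4 := lam_mono (E := E) (F := F)
          (Finset.inter_subset_right : G ∩ insert a Q ⊆ insert a Q)
        omega
    · right; omega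

/-- exchange lemma -/
theorem exchange {E : ℕ} {F V R : ℕ → Finset ℤ} {G Q : Finset ℤ} (hR : R E = ∅)
    (hRQ : bcost E F Q R = lam E F Q) (hGQ : lam E F G = lam E F Q) (hG1 : G ⊆ Q) (hG2 : G ⊆ V 0) :
    Q ⊆ V 0 ∪ R 0 ∧ ∀ j ≤ E, cnt (fun i => V i ∪ R i) F j ≤ cnt V F j := by
  have main : ∀ j ≤ E, (Q \ R 0).card + cnt R F j ≤ 
      (if j = 0 then (G \ R 0).card else (G \ (R 0 ∩ V 0)).card) + 
        cnt (fun i => if i < j then R i ∩ V i else R i) F j := by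
    intro j hj
    have h1 : lam E F G ≤ bcost E F G (fun i => if i < j then R i ∩ V i else R i) :=
      lam_le (by split_ifs <;> simp [hR])
    rw [hGQ, ← hRQ] at h1
    unfold bcost at h1
    have h2 : ∀ X : ℕ → Finset ℤ, cnt X F E = cnt X F j + ∑ i ∈ Finset.Ico j E, (bd X F i).card := by
      intro X
      unfold cnt
      rw [Finset.sum_range_add_sum_Ico _ hj]
    rw [h2, h2 (fun i => if i < j then R i ∩ V i else R i)] at h1
    have h3 : ∑ i ∈ Finset.Ico j E, (bd (fun i => if i < j then R i ∩ V i else R i) F i).card =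
        ∑ i ∈ Finset.Ico j E, (bd R F i).card := by
      apply Finset.sum_congr rfl
      intro i hi
      have := (Finset.mem_Ico.1 hi).1
      unfold bd
      dsimp only
      rw [if_neg (by omega), if_neg (by omega)]
    rw [h3] at h1
    rcases Nat.eq_zero_or_pos j with rfl | hj0
    · simp only [Nat.not_lt_zero, if_false, if_true] at h1 ⊢
      omega
    · simp only [hj0, if_true] at h1
      rw [if_neg (by omega)]
      omega
  -- levelwise
  have hlev : ∀ j ≤ E, cnt (fun i => V i ∪ R i) F j + cnt (fun i => if i < j then R i ∩ V i else R i) F j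
      ≤ cnt V F j + cnt R F j := by
    intro j hj
    unfold cnt
    rw [← Finset.sum_add_distrib, ← Finset.sum_add_distrib]
    apply Finset.sum_le_sum
    intro i hi
    have hij := Finset.mem_range.1 hi
    by_cases h : i + 1 < j
    · apply sub4 <;> intro x <;>
        simp only [Finset.mem_union, Finset.mem_inter, mem_bd, hij, h, if_true] <;> tauto
    · apply sub4 <;> intro x <;>
        simp only [Finset.mem_union, Finset.mem_inter, mem_bd, hij, h, if_true, if_false] <;> tauto
  have hGle : (G \ R 0).card ≤ (Q \ R 0).card :=
    Finset.card_le_card (Finset.sdiff_subset_sdiff hG1 (Finset.Subset.refl _))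
  constructor
  · have h0 := main 0 (by omega)
    simp only [if_true, cnt_zero] at h0
    have : G \ R 0 = Q \ R 0 :=
      Finset.eq_of_subset_of_card_le (Finset.sdiff_subset_sdiff hG1 (Finset.Subset.refl _)) (by omega)
    intro x hx
    rw [Finset.mem_union]
    by_cases hxR : x ∈ R 0
    · exact Or.inr hxR
    · left
      have : x ∈ G \ R 0 := by rw [this]; exact Finset.mem_sdiff.2 ⟨hx, hxR⟩
      exact hG2 (Finset.mem_sdiff.1 this).1
  · intro j hj
    have h1 := hlev j hj
    have h2 := main j hj
    have h3 : G \ (R 0 ∩ V 0) = G \ R 0 := by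
      ext x; simp only [Finset.mem_sdiff, Finset.mem_inter]; have := @hG2 x; tauto
    rw [h3] at h2
    have : (if j = 0 then (G \ R 0).card else (G \ R 0).card) = (G \ R 0).card := by split_ifs <;> rfl
    omega

end EP

namespace EP

def PT (W : ℕ → Finset ℤ) (e l : ℕ) (a : ℤ) : Prop :=
  ∃ p, IsPath p ∧ p l = a ∧ ∀ n ≤ e, p n ∈ W n

theorem PT.le {W : ℕ → Finset ℤ} {e e' l : ℕ} {a : ℤ} (h : PT W e l a) (he : e' ≤ e) : PT W e' l a := by
  obtain ⟨p, h1, h2, h3⟩ := h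
  exact ⟨p, h1, h2, fun n hn => h3 n (hn.trans he)⟩

theorem PT.mono {W Y : ℕ → Finset ℤ} {e l : ℕ} {a : ℤ} (h : PT W e l a) (hY : ∀ i, W i ⊆ Y i) :
    PT Y e l a := by
  obtain ⟨p, h1, h2, h3⟩ := h
  exact ⟨p, h1, h2, fun n hn => hY n (h3 n hn)⟩

theorem extremes {W : ℕ → Finset ℤ} {E : ℕ} {p : ℕ → ℤ} (hp : IsPath p) (hpW : ∀ n ≤ E, p n ∈ W n) :
    ∃ m, IsPath m ∧ ∃ M, IsPath M ∧ (∀ i ≤ E, PT W E i (m i)) ∧ (∀ i ≤ E, PT W E i (M i)) ∧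
      ∀ i ≤ E, ∀ a, PT W E i a → m i ≤ a ∧ a ≤ M i := by
  set Al : ℕ → Set ℤ := fun i => {a | PT W E (min i E) a} with hAl
  have hne : ∀ i, (Al i).Nonempty := fun i => ⟨p (min i E), p, hp, rfl, hpW⟩
  have hsub : ∀ i, Al i ⊆ (W (min i E) : Set ℤ) := by
    rintro i a ⟨q, hq, rfl, hqW⟩
    exact hqW _ (min_le_right _ _)
  have hfin : ∀ i, (Al i).Finite := fun i => (Finset.finite_toSet _).subset (hsub i)
  have hbb : ∀ i, BddBelow (Al i) := fun i => (hfin i).bddBelow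
  have hba : ∀ i, BddAbove (Al i) := fun i => (hfin i).bddAbove
  have hmm : ∀ i, sInf (Al i) ∈ Al i := fun i => Int.csInf_mem (hne i) (hbb i)
  have hMM : ∀ i, sSup (Al i) ∈ Al i := fun i => Int.csSup_mem (hne i) (hba i)
  have hup : ∀ i < E, ∀ a ∈ Al i, ∃ b ∈ Al (i + 1), b = a ∨ b = a + 1 := by
    intro i hi a ha
    obtain ⟨q, hq, hqa, hqW⟩ := ha
    rw [min_eq_left hi.le] at hqa
    refine ⟨q (i + 1), ⟨q, hq, ?_, hqW⟩, ?_⟩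
    · rw [min_eq_left hi]
    · rw [← hqa]; exact hq i
  have hdn : ∀ i < E, ∀ b ∈ Al (i + 1), ∃ a ∈ Al i, b = a ∨ b = a + 1 := by
    intro i hi b hb
    obtain ⟨q, hq, hqb, hqW⟩ := hb
    rw [min_eq_left (Nat.succ_le_of_lt hi)] at hqb
    refine ⟨q i, ⟨q, hq, ?_, hqW⟩, ?_⟩
    · rw [min_eq_left hi.le]
    · rw [← hqb]; exact hq i
  have hconst : ∀ i, E ≤ i → Al (i + 1) = Al i := by
    intro i hi
    simp only [hAl]
    rw [min_eq_right hi, min_eq_right (by omega)]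
  refine ⟨fun i => sInf (Al i), ?_, fun i => sSup (Al i), ?_, ?_, ?_, ?_⟩
  · intro i
    dsimp only
    rcases lt_or_ge i E with hi | hi
    · obtain ⟨b, hb, hb'⟩ := hup i hi _ (hmm i)
      obtain ⟨a, ha, ha'⟩ := hdn i hi _ (hmm (i + 1))
      have := csInf_le (hbb _) ha
      have := csInf_le (hbb _) hb
      omega
    · rw [hconst i hi]; simp
  · intro i
    dsimp only
    rcases lt_or_ge i E with hi | hi
    · obtain ⟨b, hb, hb'⟩ := hup i hi _ (hMM i)
      obtain ⟨a, ha, ha'⟩ := hdn i hi _ (hMM (i + 1))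
      have := le_csSup (hba _) ha
      have := le_csSup (hba _) hb
      omega
    · rw [hconst i hi]; simp
  · intro i hi
    have this : PT W E (min i E) (sInf (Al i)) := hmm i
    rw [min_eq_left hi] at this; exact this
  · intro i hi
    have this : PT W E (min i E) (sSup (Al i)) := hMM i
    rw [min_eq_left hi] at this; exact this
  · intro i hi a ha
    have : a ∈ Al i := by
      change PT W E (min i E) a; rwa [min_eq_left hi]
    exact ⟨csInf_le (hbb _) this, le_csSup (hba _) this⟩

theorem cnt_ext {W Y F : ℕ → Finset ℤ} {E : ℕ} {d : ℕ} (h : cnt Y F E ≤ cnt W F E + d)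
    (h2 : ∀ i, E ≤ i → bd Y F i ⊆ bd W F i) (j : ℕ) (hj : E ≤ j) : cnt Y F j ≤ cnt W F j + d := by
  induction j, hj using Nat.le_induction with
  | base => exact h
  | succ n hn ih =>
    rw [cnt_succ, cnt_succ]
    have := Finset.card_le_card (h2 n hn)
    omega

/-- paid frame: filling in everything reachable -/
theorem paid_frame {W F : ℕ → Finset ℤ} {h : ℕ} (hh : 1 ≤ h) {S A : Finset ℤ} (hW0 : W 0 = S)
    (hcov : rch F A h ⊆ rch F S h) (hc : cnt W F h ≤ h) :
    ∃ Y : ℕ → Finset ℤ, (∀ i, W i ⊆ Y i) ∧ A ⊆ Y 0 ∧ (∀ j < h, cnt Y F j ≤ cnt W F j) ∧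
      (∀ j, cnt Y F j ≤ cnt W F j + h ^ 2) ∧ ∀ j, h ≤ j → Y j = W j := by
  set Y : ℕ → Finset ℤ := fun i => if i < h then W i ∪ rch F A i else W i with hY
  have hYlt : ∀ i < h, Y i = W i ∪ rch F A i := fun i hi => by simp only [hY, if_pos hi]
  have hYge : ∀ i, h ≤ i → Y i = W i := fun i hi => by
    simp only [hY]; rw [if_neg (by omega)]
  have hWY : ∀ i, W i ⊆ Y i := by
    intro i
    rcases lt_or_ge i h with hi | hi
    · rw [hYlt i hi]; exact Finset.subset_union_left
    · rw [hYge i hi]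
  have hlt : ∀ i, i + 1 < h → bd Y F i ⊆ bd W F i := by
    intro i hi x hx
    rw [mem_bd, hYlt i (by omega), hYlt (i+1) hi] at hx
    simp only [Finset.mem_union, rch, Finset.mem_sdiff, mem_Nx] at hx
    rw [mem_bd]
    tauto
  have hge : ∀ i, h ≤ i → bd Y F i ⊆ bd W F i := by
    intro i hi x hx
    rw [mem_bd, hYge i hi, hYge (i+1) (by omega)] at hx
    rw [mem_bd]; exact hx
  -- claim on rch S \ W
  have horig : ∀ j, ∀ x ∈ rch F S j, x ∉ W j → ∃ i < j, ∃ y ∈ bd W F i, y ≤ x ∧ x + i + 1 ≤ y + j := by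
    intro j
    induction j with
    | zero => intro x hx hxW; rw [hW0] at hxW; exact absurd hx hxW
    | succ n ih =>
      intro x hx hxW
      rw [rch, Finset.mem_sdiff, mem_Nx] at hx
      obtain ⟨hx1, hxF⟩ := hx
      have hpar : ∃ z ∈ rch F S n, x = z ∨ x = z + 1 := by
        rcases hx1 with h | h
        · exact ⟨_, h, Or.inl rfl⟩
        · exact ⟨_, h, Or.inr (by ring)⟩
      obtain ⟨z, hz, hxz⟩ := hpar
      by_cases hzW : z ∈ W n
      · refine ⟨n, by omega, x, mem_bd.2 ⟨?_, hxW, hxF⟩, le_rfl, by push_cast; omega⟩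
        rcases hxz with rfl | rfl
        · exact Or.inl hzW
        · right; simpa using hzW
      · obtain ⟨i, hi, y, hy, hy1, hy2⟩ := ih z hz hzW
        exact ⟨i, by omega, y, hy, by omega, by push_cast; omega⟩
  have hcard : (rch F A h \ W h).card ≤ h ^ 2 := by
    have hs : rch F A h \ W h ⊆ (Finset.range h).biUnion (fun i => (bd W F i).biUnion (fun y =>
        Finset.Icc y (y + h - 1))) := by
      intro x hx
      rw [Finset.mem_sdiff] at hx
      obtain ⟨i, hi, y, hy, hy1, hy2⟩ := horig h x (hcov hx.1) hx.2
      rw [Finset.mem_biUnion]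
      refine ⟨i, Finset.mem_range.2 hi, ?_⟩
      rw [Finset.mem_biUnion]
      exact ⟨y, hy, Finset.mem_Icc.2 ⟨hy1, by omega⟩⟩
    refine (Finset.card_le_card hs).trans (Finset.card_biUnion_le.trans ?_)
    have : ∀ i ∈ Finset.range h, ((bd W F i).biUnion (fun y => Finset.Icc y (y + h - 1))).card ≤
        (bd W F i).card * h := by
      intro i _
      apply Finset.card_biUnion_le_card_mul
      intro y _
      rw [Int.card_Icc]; omega
    refine (Finset.sum_le_sum this).trans ?_
    rw [← Finset.sum_mul, pow_two]
    exact Nat.mul_le_mul_right _ hc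
  obtain ⟨h', rfl⟩ : ∃ h', h = h' + 1 := ⟨h - 1, by omega⟩
  have hlast : bd Y F h' ⊆ bd W F h' ∪ (rch F A (h' + 1) \ W (h' + 1)) := by
    intro x hx
    rw [mem_bd, hYlt h' (by omega), hYge (h'+1) le_rfl] at hx
    simp only [Finset.mem_union, rch, Finset.mem_sdiff, mem_Nx] at hx ⊢
    rw [mem_bd]
    tauto
  have hlow : ∀ j < h' + 1, cnt Y F j ≤ cnt W F j := by
    intro j hj
    apply Finset.sum_le_sum
    intro i hi
    exact Finset.card_le_card (hlt i (by have := Finset.mem_range.1 hi; omega))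
  refine ⟨Y, hWY, ?_, hlow, ?_, hYge⟩
  · rw [hYlt 0 (by omega)]; exact Finset.subset_union_right
  · intro j
    rcases lt_or_ge j (h' + 1) with hj | hj
    · exact (hlow j hj).trans (by omega)
    · refine cnt_ext ?_ hge j hj
      rw [cnt_succ, cnt_succ]
      have := hlow h' (by omega)
      have := (Finset.card_le_card hlast).trans (Finset.card_union_le _ _)
      omega

def Lossless (W F Y : ℕ → Finset ℤ) (E : ℕ) : Prop :=
  (∀ j, cnt Y F j ≤ cnt W F j) ∧ (∀ j, E ≤ j → Y j = W j) ∧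
  ∀ l e a u b, E ≤ e → PT W e l a → PT W e l b → a < u → u < b → u ∉ W l → u ∈ Y l →
    ∃ k, l < k ∧ k < E ∧ ∀ a u b, PT W e k a → PT W e k b → a < u → u < b → u ∈ W k

theorem dead_frame {W F : ℕ → Finset ℤ} {E K : ℕ} {S A : Finset ℤ} (hE : 0 < E) (hSA : S ⊆ A) (hW0 : W 0 = S)
    (hGL : greedy E F id K A ⊆ S) (hc : cnt W F E ≤ K)
    (hdead : ¬ ∃ p, IsPath p ∧ ∀ n ≤ E, p n ∈ W n) :
    ∃ Y : ℕ → Finset ℤ, (∀ i, W i ⊆ Y i) ∧ A ⊆ Y 0 ∧ Lossless W F Y E := by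
  have hup : up W S E = ∅ := by
    rw [Finset.eq_empty_iff_forall_notMem]
    intro x hx
    obtain ⟨p, hp, -, hp0, hpW⟩ := up_path E x hx
    refine hdead ⟨p, hp, ?_⟩
    intro n hn
    rcases Nat.eq_zero_or_pos n with rfl | hn0
    · rwa [hW0]
    · exact hpW n hn0 hn
  have hlS : lam E F S ≤ K := (lam_alive (by rw [hW0]) hup).trans hc
  have hG : lam E F S = lam E F A := by
    apply le_antisymm (lam_mono hSA)
    have h1 := greedy_prefix (E := E) (F := F) (key := id) Function.injective_id (K := K) (A := A) A
      (Finset.Subset.refl _) (fun a ha b hb _ => ha)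
    have h2 : lam E F (greedy E F id K A ∩ A) ≤ lam E F S :=
      lam_mono (Finset.inter_subset_left.trans hGL)
    omega
  obtain ⟨R, hR, hRe⟩ := lam_exists E F A
  obtain ⟨h1, h2⟩ := exchange (V := W) hR hRe hG hSA (by rw [hW0])
  set Y : ℕ → Finset ℤ := fun i => if i < E then W i ∪ R i else W i with hY
  have hYlt : ∀ i ≤ E, Y i = W i ∪ R i := fun i hi => by
    simp only [hY]
    split_ifs with hlt
    · rfl
    · have : i = E := by omega
      subst this; rw [hR]; simp
  have hYge : ∀ i, E ≤ i → Y i = W i := fun i hi => by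
    simp only [hY]; rw [if_neg (by omega)]
  have hcntY : ∀ j ≤ E, cnt Y F j = cnt (fun i => W i ∪ R i) F j := by
    intro j hj
    apply Finset.sum_congr rfl
    intro i hi
    have := Finset.mem_range.1 hi
    unfold bd
    rw [hYlt i (by omega), hYlt (i+1) (by omega)]
  refine ⟨Y, ?_, ?_, ?_, hYge, ?_⟩
  · intro i
    simp only [hY]
    split_ifs
    · exact Finset.subset_union_left
    · exact Finset.Subset.refl _
  · rw [hYlt 0 (by omega)]; exact h1
  · intro j
    rcases le_or_gt j E with hj | hj
    · rw [hcntY j hj]; exact h2 j hj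
    · refine cnt_ext (d := 0) (by rw [hcntY E le_rfl]; exact h2 E le_rfl) ?_ j hj.le
      intro i hi x hx
      rw [mem_bd, hYge i hi, hYge (i+1) (by omega)] at hx
      rw [mem_bd]; exact hx
  · rintro l e a u b he ⟨p, hp, -, hpW⟩
    exact absurd ⟨p, hp, fun n hn => hpW n (hn.trans he)⟩ hdead

theorem closed_frame {W F : ℕ → Finset ℤ} {E K k : ℕ} {S A : Finset ℤ} (hSA : S ⊆ A) (hW0 : W 0 = S)
    (hGL : greedy E F id K A ⊆ S) (hGR : greedy E F (fun x => -x) K A ⊆ S) (hc : cnt W F E ≤ K)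
    {m M : ℕ → ℤ} (hm : IsPath m) (hM : IsPath M)
    (hmP : ∀ i ≤ E, PT W E i (m i)) (hMP : ∀ i ≤ E, PT W E i (M i))
    (hext : ∀ i ≤ E, ∀ a, PT W E i a → m i ≤ a ∧ a ≤ M i)
    (hk0 : 0 < k) (hkE : k < E) (hcl : Finset.Icc (m k) (M k) ⊆ W k) :
    ∃ Y : ℕ → Finset ℤ, (∀ i, W i ⊆ Y i) ∧ A ⊆ Y 0 ∧ Lossless W F Y E := by
  have hmW : ∀ i ≤ E, m i ∈ W i := by
    intro i hi
    obtain ⟨p, _, h, h'⟩ := hmP i hi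
    rw [← h]; exact h' i hi
  have hMW : ∀ i ≤ E, M i ∈ W i := by
    intro i hi
    obtain ⟨p, _, h, h'⟩ := hMP i hi
    rw [← h]; exact h' i hi
  -- sides
  have hside : ∀ B : Finset ℤ, B ⊆ S → (∀ x ∈ B, ¬ (m 0 ≤ x ∧ x ≤ M 0)) → lam E F B ≤ K := by
    intro B hB hBm
    refine (lam_alive (by rw [hW0]; exact hB) ?_).trans hc
    rw [Finset.eq_empty_iff_forall_notMem]
    intro x hx
    obtain ⟨p, hp, -, hp0, hpW⟩ := up_path E x hx
    refine hBm _ hp0 (hext 0 (by omega) _ ⟨p, hp, rfl, ?_⟩)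
    intro n hn
    rcases Nat.eq_zero_or_pos n with rfl | hn0
    · rw [hW0]; exact hB hp0
    · exact hpW n hn0 hn
  set QL := A.filter (fun x => x < m 0) with hQL
  set QR := A.filter (fun x => M 0 < x) with hQR
  have hl1 : lam E F (S ∩ QL) = lam E F QL := by
    apply le_antisymm (lam_mono Finset.inter_subset_right)
    have h1 := greedy_prefix (E := E) (F := F) (key := id) Function.injective_id (K := K) (A := A) QL
      (Finset.filter_subset _ _) (by
        intro a ha b hb hab
        simp only [hQL, Finset.mem_filter, id] at *
        exact ⟨ha, by omega⟩)
    have h2 : lam E F (greedy E F id K A ∩ QL) ≤ lam E F (S ∩ QL) :=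
      lam_mono (Finset.inter_subset_inter_right hGL)
    have h3 := hside (S ∩ QL) Finset.inter_subset_left (by
      intro x hx
      simp only [hQL, Finset.mem_filter, Finset.mem_inter] at hx
      omega)
    omega
  have hl2 : lam E F (S ∩ QR) = lam E F QR := by
    apply le_antisymm (lam_mono Finset.inter_subset_right)
    have h1 := greedy_prefix (E := E) (F := F) (key := fun x => -x) neg_injective (K := K) (A := A) QR
      (Finset.filter_subset _ _) (by
        intro a ha b hb hab
        simp only [hQR, Finset.mem_filter] at *
        exact ⟨ha, by omega⟩)
    have h2 : lam E F (greedy E F (fun x => -x) K A ∩ QR) ≤ lam E F (S ∩ QR) :=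
      lam_mono (Finset.inter_subset_inter_right hGR)
    have h3 := hside (S ∩ QR) Finset.inter_subset_left (by
      intro x hx
      simp only [hQR, Finset.mem_filter, Finset.mem_inter] at hx
      omega)
    omega
  have hlam : lam E F ((S ∩ QL) ∪ (S ∩ QR)) = lam E F (QL ∪ QR) := by
    rw [lam_span (S ∩ QR) Finset.inter_subset_right hl1, Finset.union_comm,
      lam_span QL Finset.inter_subset_right hl2, Finset.union_comm]
  obtain ⟨R, hR, hRe⟩ := lam_exists E F (QL ∪ QR)
  obtain ⟨h1, h2⟩ := exchange (V := fun i => W i ∪ Finset.Icc (m i) (M i)) hR hRe hlam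
    (Finset.union_subset_union Finset.inter_subset_right Finset.inter_subset_right) (by
      intro x hx
      rw [hW0]
      simp only [Finset.mem_union, Finset.mem_inter] at hx ⊢
      tauto)
  set Y : ℕ → Finset ℤ := fun i => if i < E then 
    (W i ∪ (R i \ Finset.Icc (m i) (M i))) ∪ (if i < k then Finset.Icc (m i) (M i) else ∅) else W i with hY
  have hYmem : ∀ i ≤ E, ∀ x, x ∈ Y i ↔ x ∈ W i ∨ (x ∈ R i ∧ x ∉ Finset.Icc (m i) (M i)) ∨ 
      (i < k ∧ x ∈ Finset.Icc (m i) (M i)) := by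
    intro i hi x
    simp only [hY]
    split_ifs with h3 h4
    · simp only [Finset.mem_union, Finset.mem_sdiff, h4, true_and, or_assoc]
    · simp only [Finset.mem_union, Finset.mem_sdiff, h4, false_and, Finset.notMem_empty, or_false]
    · have : i = E := by omega
      subst this
      have : ¬ i < k := by omega
      simp [hR, this]
  have hYge : ∀ i, E ≤ i → Y i = W i := fun i hi => by
    simp only [hY]; rw [if_neg (by omega)]
  have hbdge : ∀ i, E ≤ i → bd Y F i ⊆ bd W F i := by
    intro i hi x hx
    rw [mem_bd, hYge i hi, hYge (i+1) (by omega)] at hx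
    rw [mem_bd]; exact hx
  have hV' : ∀ i < E, bd (fun i => W i ∪ Finset.Icc (m i) (M i)) F i ⊆
      bd W F i \ Finset.Icc (m (i+1)) (M (i+1)) := by
    intro i hi x hx
    rw [mem_bd] at hx
    obtain ⟨hp, hxY, hF⟩ := hx
    rw [Finset.mem_union, not_or] at hxY
    have hpar : ∃ z ∈ W i ∪ Finset.Icc (m i) (M i), x = z ∨ x = z + 1 := by
      rcases hp with h | h
      · exact ⟨_, h, Or.inl rfl⟩
      · exact ⟨_, h, Or.inr (by ring)⟩
    obtain ⟨z, hz, hxz⟩ := hpar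
    by_cases hzW : z ∈ W i
    · rw [Finset.mem_sdiff, mem_bd]
      refine ⟨⟨?_, hxY.1, hF⟩, hxY.2⟩
      rcases hxz with rfl | rfl
      · exact Or.inl hzW
      · right; simpa using hzW
    · have hz' := (Finset.mem_union.1 hz).resolve_left hzW
      exact absurd (fill_child hm hM (hmW i hi.le) (hMW i hi.le) hz' hzW hxz) hxY.2
  have hbdY : ∀ i < E, bd Y F i ⊆ (bd W F i ∩ Finset.Icc (m (i+1)) (M (i+1))) ∪
      bd (fun i => (W i ∪ Finset.Icc (m i) (M i)) ∪ R i) F i := by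
    intro i hi x hx
    rw [mem_bd, hYmem (i+1) hi] at hx
    obtain ⟨hp, hxY, hF⟩ := hx
    push Not at hxY
    obtain ⟨hxW, hxR, hxk⟩ := hxY
    have hpar : ∃ z ∈ Y i, x = z ∨ x = z + 1 := by
      rcases hp with h | h
      · exact ⟨_, h, Or.inl rfl⟩
      · exact ⟨_, h, Or.inr (by ring)⟩
    obtain ⟨z, hz, hxz⟩ := hpar
    rw [hYmem i hi.le] at hz
    rw [Finset.mem_union]
    by_cases hxN : x ∈ Finset.Icc (m (i+1)) (M (i+1))
    · left
      by_cases hzW : z ∈ W i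
      · rw [Finset.mem_inter, mem_bd]
        refine ⟨⟨?_, hxW, hF⟩, hxN⟩
        rcases hxz with rfl | rfl
        · exact Or.inl hzW
        · right; simpa using hzW
      · exfalso
        rcases hz with hz | hz | hz
        · exact hzW hz
        · have hz2 := hz.2
          have e1 : x ≠ m (i+1) := by rintro rfl; exact hxW (hmW _ hi)
          have e2 : x ≠ M (i+1) := by rintro rfl; exact hxW (hMW _ hi)
          have := hm i
          have := hM i
          rw [Finset.mem_Icc] at hz2 hxN
          omega
        · have hik : i + 1 = k := by
            by_contra hne
            exact hxk (by omega) hxN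
          subst hik
          exact hxW (hcl hxN)
    · right
      rw [mem_bd]
      have hz' : z ∈ (W i ∪ Finset.Icc (m i) (M i)) ∪ R i := by
        simp only [Finset.mem_union]; tauto
      refine ⟨?_, ?_, hF⟩
      · rcases hxz with rfl | rfl
        · exact Or.inl hz'
        · right; simpa using hz'
      · simp only [Finset.mem_union]
        have := fun h => hxN (hxR h)
        tauto
  have hcnt : ∀ j ≤ E, cnt Y F j ≤ cnt W F j := by
    intro j hj
    have e1 : cnt Y F j ≤ ∑ i ∈ Finset.range j, (bd W F i ∩ Finset.Icc (m (i+1)) (M (i+1))).card +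
        cnt (fun i => (W i ∪ Finset.Icc (m i) (M i)) ∪ R i) F j := by
      unfold cnt
      rw [← Finset.sum_add_distrib]
      apply Finset.sum_le_sum
      intro i hi
      have := Finset.mem_range.1 hi
      exact (Finset.card_le_card (hbdY i (by omega))).trans (Finset.card_union_le _ _)
    have e2 := h2 j hj
    have e3 : ∑ i ∈ Finset.range j, (bd W F i ∩ Finset.Icc (m (i+1)) (M (i+1))).card +
        cnt (fun i => W i ∪ Finset.Icc (m i) (M i)) F j ≤ cnt W F j := by
      unfold cnt
      rw [← Finset.sum_add_distrib]
      apply Finset.sum_le_sum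
      intro i hi
      have := Finset.mem_range.1 hi
      have h5 := Finset.card_le_card (hV' i (by omega))
      have h6 := Finset.card_sdiff_add_card_inter (bd W F i) (Finset.Icc (m (i + 1)) (M (i + 1)))
      omega
    omega
  refine ⟨Y, ?_, ?_, ?_, hYge, ?_⟩
  · intro i x hx
    rcases le_or_gt i E with hi | hi
    · rw [hYmem i hi]; exact Or.inl hx
    · rw [hYge i hi.le]; exact hx
  · intro x hx
    rw [hYmem 0 (by omega)]
    by_cases hxN : x ∈ Finset.Icc (m 0) (M 0)
    · exact Or.inr (Or.inr ⟨hk0, hxN⟩)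
    · have hxQ : x ∈ QL ∪ QR := by
        simp only [hQL, hQR, Finset.mem_union, Finset.mem_filter, Finset.mem_Icc] at hxN ⊢
        by_cases h : x < m 0
        · exact Or.inl ⟨hx, h⟩
        · exact Or.inr ⟨hx, by omega⟩
      have := h1 hxQ
      simp only [Finset.mem_union] at this
      tauto
  · intro j
    rcases le_or_gt j E with hj | hj
    · exact hcnt j hj
    · exact cnt_ext (d := 0) (hcnt E le_rfl) hbdge j hj.le
  · intro l e a u b he ha hb hau hub huW huY
    rcases le_or_gt l E with hl | hl
    · rw [hYmem l hl] at huY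
      have h3 := hext l hl a (ha.le he)
      have h4 := hext l hl b (hb.le he)
      have huN : u ∈ Finset.Icc (m l) (M l) := Finset.mem_Icc.2 ⟨by omega, by omega⟩
      refine ⟨k, by tauto, hkE, ?_⟩
      intro a u b ha hb hau hub
      have h3 := hext k hkE.le a (ha.le he)
      have h4 := hext k hkE.le b (hb.le he)
      exact hcl (Finset.mem_Icc.2 ⟨by omega, by omega⟩)
    · rw [hYge l hl.le] at huY
      exact absurd huY huW

theorem bad_frame {W F : ℕ → Finset ℤ} {E K h : ℕ} {S A : Finset ℤ} (hh : 1 ≤ h) (hhE : h ≤ E)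
    (hSA : S ⊆ A) (hW0 : W 0 = S)
    (hGL : greedy E F id K A ⊆ S) (hGR : greedy E F (fun x => -x) K A ⊆ S)
    (hcov : rch F A h ⊆ rch F S h) (hc : cnt W F E ≤ K) (hch : cnt W F h ≤ h) :
    ∃ Y : ℕ → Finset ℤ, (∀ i, W i ⊆ Y i) ∧ A ⊆ Y 0 ∧ (Lossless W F Y E ∨ 
      ((∀ j < h, cnt Y F j ≤ cnt W F j) ∧
      (∀ j, cnt Y F j ≤ cnt W F j + h ^ 2) ∧ (∀ j, h ≤ j → Y j = W j) ∧
      ∀ l, h ≤ l → l < E → ∃ a u b, PT W E l a ∧ PT W E l b ∧ a < u ∧ u < b ∧ u ∉ W l)) := by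
  by_cases hal : ∃ p, IsPath p ∧ ∀ n ≤ E, p n ∈ W n
  · obtain ⟨p, hp, hpW⟩ := hal
    obtain ⟨m, hm, M, hM, hmP, hMP, hext⟩ := extremes hp hpW
    by_cases hcl : ∃ k, h ≤ k ∧ k < E ∧ Finset.Icc (m k) (M k) ⊆ W k
    · obtain ⟨k, hk1, hk2, hk3⟩ := hcl
      obtain ⟨Y, h1, h2, h3⟩ := closed_frame hSA hW0 hGL hGR hc hm hM hmP hMP hext (by omega) hk2 hk3
      exact ⟨Y, h1, h2, Or.inl h3⟩
    · obtain ⟨Y, h1, h2, h3, h4, h5⟩ := paid_frame hh hW0 hcov hch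
      refine ⟨Y, h1, h2, Or.inr ⟨h3, h4, h5, ?_⟩⟩
      intro l hl1 hl2
      have : ∃ u ∈ Finset.Icc (m l) (M l), u ∉ W l := by
        by_contra hcon
        push Not at hcon
        exact hcl ⟨l, hl1, hl2, hcon⟩
      obtain ⟨u, hu, huW⟩ := this
      rw [Finset.mem_Icc] at hu
      obtain ⟨q, _, hq1, hq2⟩ := hmP l hl2.le
      obtain ⟨q', _, hq1', hq2'⟩ := hMP l hl2.le
      have e1 : u ≠ m l := by rintro rfl; rw [← hq1] at huW; exact huW (hq2 l hl2.le)
      have e2 : u ≠ M l := by rintro rfl; rw [← hq1'] at huW; exact huW (hq2' l hl2.le)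
      exact ⟨m l, u, M l, hmP l hl2.le, hMP l hl2.le, by omega, by omega, huW⟩
  · obtain ⟨Y, h1, h2, h3⟩ := dead_frame (by omega) hSA hW0 hGL hc hal
    exact ⟨Y, h1, h2, Or.inl h3⟩

end EP

namespace EP

theorem grouping (h E : ℕ → ℕ) (hE : ∀ s, 0 < E s) (n : ℕ) : ∀ P : Finset ℕ, P.card = n →
    (∀ Q ⊆ P, ∀ s ∈ Q, (∀ s' ∈ Q, s ≤ s' ∧ s' < s + E s) → ∑ s' ∈ Q, h s' ^ 2 + h s ≤ E s) →
    ∑ s ∈ P, h s ^ 2 ≤ (P.biUnion (fun s => Finset.Ico (s + h s) (s + E s))).card := by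
  induction n using Nat.strong_induction_on with
  | _ n ih =>
    intro P hPn hP
    rcases P.eq_empty_or_nonempty with rfl | hne
    · simp
    obtain ⟨t, htP, hmin⟩ : ∃ t ∈ P, ∀ s ∈ P, t ≤ s := ⟨P.min' hne, P.min'_mem hne, fun s hs => P.min'_le s hs⟩
    have h1 := hP (P.filter (fun s => s < t + E t)) (Finset.filter_subset _ _) t
      (Finset.mem_filter.2 ⟨htP, by have := hE t; omega⟩) (by
        intro s' hs'
        rw [Finset.mem_filter] at hs'
        exact ⟨hmin s' hs'.1, hs'.2⟩)
    have hlt : (P.filter (fun s => ¬ s < t + E t)).card < n := by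
      rw [← hPn]
      apply Finset.card_lt_card
      rw [Finset.filter_ssubset]
      exact ⟨t, htP, by have := hE t; omega⟩
    have h2 := ih _ hlt _ rfl (fun Q hQ s hs hsQ => hP Q (hQ.trans (Finset.filter_subset _ _)) s hs hsQ)
    have h3 := Finset.sum_filter_add_sum_filter_not P (fun s => s < t + E t) (fun s => h s ^ 2)
    set U := (P.filter (fun s => ¬ s < t + E t)).biUnion (fun s => Finset.Ico (s + h s) (s + E s)) with hU
    have hdis : Disjoint (Finset.Ico (t + h t) (t + E t)) U := by
      rw [Finset.disjoint_left]
      intro x hx hxU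
      rw [hU, Finset.mem_biUnion] at hxU
      obtain ⟨s, hs, hxs⟩ := hxU
      rw [Finset.mem_filter] at hs
      rw [Finset.mem_Ico] at hx hxs
      omega
    have hsub : Finset.Ico (t + h t) (t + E t) ∪ U ⊆ P.biUnion (fun s => Finset.Ico (s + h s) (s + E s)) := by
      apply Finset.union_subset
      · exact Finset.subset_biUnion_of_mem (fun s => Finset.Ico (s + h s) (s + E s)) htP
      · exact Finset.biUnion_subset_biUnion_of_subset_left _ (Finset.filter_subset _ _)
    have h4 := Finset.card_le_card hsub
    rw [Finset.card_union_of_disjoint hdis, Nat.card_Ico] at h4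
    omega

theorem peel {Y F1 F2 Z : ℕ → Finset ℤ} (hZ : ∀ i, Z (i + 1) = Y i)
    (hA : Nx (Z 0) \ F2 1 ⊆ Y 0) (hF : ∀ L, ∑ n ∈ Finset.range L, (F2 n \ F1 n).card ≤ 1) (j : ℕ) :
    cnt Z F1 (j + 1) ≤ cnt Y (fun i => F2 (i + 1)) j + 1 := by
  have h0 : bd Z F1 0 ⊆ F2 1 \ F1 1 := by
    intro x hx
    rw [mem_bd, hZ] at hx
    have := @hA x
    simp only [Finset.mem_sdiff, mem_Nx] at this ⊢
    simp only [Nat.zero_add] at hx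
    tauto
  have h1 : ∀ i, bd Z F1 (i + 1) ⊆ bd Y (fun i => F2 (i + 1)) i ∪ (F2 (i + 2) \ F1 (i + 2)) := by
    intro i x hx
    rw [mem_bd, hZ, hZ] at hx
    simp only [Finset.mem_union, mem_bd, Finset.mem_sdiff]
    have e : i + 1 + 1 = i + 2 := rfl
    rw [e] at *
    tauto
  unfold cnt
  rw [Finset.sum_range_succ']
  have h2 : ∑ i ∈ Finset.range j, (bd Z F1 (i + 1)).card ≤
      ∑ i ∈ Finset.range j, (bd Y (fun i => F2 (i + 1)) i).card +
      ∑ i ∈ Finset.range j, (F2 (i + 2) \ F1 (i + 2)).card := by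
    rw [← Finset.sum_add_distrib]
    apply Finset.sum_le_sum
    intro i _
    exact (Finset.card_le_card (h1 i)).trans (Finset.card_union_le _ _)
  have h3 := hF (j + 2)
  rw [Finset.sum_range_succ', Finset.sum_range_succ'] at h3
  have h4 := Finset.card_le_card h0
  simp only [Nat.zero_add] at *
  have e : ∀ i, i + 1 + 1 = i + 2 := fun _ => rfl
  simp only [e] at h3
  omega

/-- The abstract data of a play. -/
structure Play (h E : ℕ → ℕ) (bad : ℕ → Prop) (Fd : ℕ → ℕ → Finset ℤ) (S : ℕ → Finset ℤ) : Prop where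
  h1 : ∀ t, 1 ≤ h t
  hmono : Monotone h
  Emono : Monotone E
  hE : ∀ t, h t ≤ E t
  cond : ∀ s, ∀ Q : Finset ℕ, (∀ s' ∈ Q, s ≤ s' ∧ s' < s + E s ∧ bad s') → ∑ s' ∈ Q, h s' ^ 2 + h s ≤ E s
  S0 : S 0 = {0}
  F0 : ∀ n, Fd 0 n = ∅
  Fstep : ∀ t L, ∑ n ∈ Finset.range L, (Fd (t + 1) n \ Fd t n).card ≤ 1
  Ssub : ∀ t, S (t + 1) ⊆ Nx (S t) \ Fd (t + 1) (t + 1)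
  good : ∀ t, ¬ bad (t + 1) → ∀ a ∈ Nx (S t) \ Fd (t + 1) (t + 1), a ∈ S (t + 1) ∨ 
    ∃ l ∈ S (t + 1), ∃ r ∈ S (t + 1), l ≤ a ∧ a ≤ r ∧ r < l + h (t + 1) ∧
      ∀ j, 1 ≤ j → j ≤ h (t + 1) → ∀ x, l ≤ x → x ≤ r + j → x ∉ Fd (t + 1) (t + 1 + j)
  badL : ∀ t, bad (t + 1) → greedy (E (t + 1)) (fun j => Fd (t + 1) (t + 1 + j)) id (2 * E (t + 1))
    (Nx (S t) \ Fd (t + 1) (t + 1)) ⊆ S (t + 1)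
  badR : ∀ t, bad (t + 1) → greedy (E (t + 1)) (fun j => Fd (t + 1) (t + 1 + j)) (fun x => -x) (2 * E (t + 1))
    (Nx (S t) \ Fd (t + 1) (t + 1)) ⊆ S (t + 1)
  badC : ∀ t, bad (t + 1) → rch (fun j => Fd (t + 1) (t + 1 + j)) (Nx (S t) \ Fd (t + 1) (t + 1)) (h (t + 1)) ⊆
    rch (fun j => Fd (t + 1) (t + 1 + j)) (S (t + 1)) (h (t + 1))

def credit (h : ℕ → ℕ) (Pd : Finset ℕ) (n : ℕ) : ℕ := ∑ s ∈ Pd.filter (fun s => s + h s ≤ n), h s ^ 2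

structure St (h E : ℕ → ℕ) (bad : ℕ → Prop) (Fd : ℕ → ℕ → Finset ℤ) (S : ℕ → Finset ℤ) (t : ℕ)
    (W : ℕ → Finset ℤ) (Pd : Finset ℕ) : Prop where
  W0 : W 0 = S t
  fin : ∃ L, ∀ n, L ≤ n → W n = ∅
  cn : ∀ j, cnt W (fun j => Fd t (t + j)) j ≤ j + credit h Pd (t + j)
  Pdb : ∀ s ∈ Pd, t < s ∧ bad s
  paid : ∀ s ∈ Pd, ∀ l, s + h s ≤ t + l → t + l < s + E s → 
    ∃ a u b, PT W (s + E s - t) l a ∧ PT W (s + E s - t) l b ∧ a < u ∧ u < b ∧ u ∉ W l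

theorem frame_step {h E : ℕ → ℕ} {bad : ℕ → Prop} {Fd : ℕ → ℕ → Finset ℤ} {S : ℕ → Finset ℤ}
    (P : Play h E bad Fd S) (t : ℕ) {W : ℕ → Finset ℤ} {Pd : Finset ℕ}
    (H : St h E bad Fd S (t + 1) W Pd) :
    ∃ (Y : ℕ → Finset ℤ) (Pd2 : Finset ℕ), (∀ i, W i ⊆ Y i) ∧ Nx (S t) \ Fd (t + 1) (t + 1) ⊆ Y 0 ∧
      (∃ L, ∀ n, L ≤ n → Y n = ∅) ∧
      (∀ j, cnt Y (fun j => Fd (t + 1) (t + 1 + j)) j ≤ j + credit h Pd2 (t + 1 + j)) ∧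
      (∀ s ∈ Pd2, t < s ∧ bad s) ∧
      (∀ s ∈ Pd2, ∀ l, s + h s ≤ t + 1 + l → t + 1 + l < s + E s → 
        ∃ a u b, PT W (s + E s - (t + 1)) l a ∧ PT W (s + E s - (t + 1)) l b ∧ a < u ∧ u < b ∧ u ∉ Y l) := by
  obtain ⟨L, hL⟩ := H.fin
  have hch : ∀ j ≤ h (t + 1), cnt W (fun j => Fd (t + 1) (t + 1 + j)) j ≤ j := by
    intro j hj
    refine (H.cn j).trans ?_
    have : credit h Pd (t + 1 + j) = 0 := by
      unfold credit
      rw [Finset.filter_eq_empty_iff.2, Finset.sum_empty]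
      intro s hs hle
      have h1 := (H.Pdb s hs).1
      have h2 := P.hmono h1.le
      omega
    omega
  have hcE : cnt W (fun j => Fd (t + 1) (t + 1 + j)) (E (t + 1)) ≤ 2 * E (t + 1) := by
    refine (H.cn _).trans ?_
    have := P.cond (t + 1) (Pd.filter (fun s => s + h s ≤ t + 1 + E (t + 1))) (by
      intro s hs
      rw [Finset.mem_filter] at hs
      have := H.Pdb s hs.1
      have := P.h1 s
      exact ⟨by omega, by omega, (H.Pdb s hs.1).2⟩)
    unfold credit
    omega
  by_cases hb : bad (t + 1)
  · obtain ⟨Y, g1, g2, g3⟩ := bad_frame (P.h1 (t + 1)) (P.hE (t + 1)) (P.Ssub t) H.W0 (P.badL t hb) (P.badR t hb)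
      (P.badC t hb) hcE (hch _ le_rfl)
    rcases g3 with ⟨k1, k2, k3⟩ | ⟨k1, k2, k3, k4⟩
    · refine ⟨Y, Pd, g1, g2, ⟨max L (E (t + 1)), ?_⟩, ?_, ?_, ?_⟩
      · intro n hn
        rw [k2 n (le_trans (le_max_right _ _) hn)]
        exact hL n (le_trans (le_max_left _ _) hn)
      · intro j; exact (k1 j).trans (H.cn j)
      · intro s hs
        have := H.Pdb s hs
        exact ⟨by omega, this.2⟩
      · intro s hs l hl1 hl2
        obtain ⟨a, u, b, ha, hb', hau, hub, hu⟩ := H.paid s hs l hl1 hl2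
        refine ⟨a, u, b, ha, hb', hau, hub, ?_⟩
        intro huY
        have hs1 := (H.Pdb s hs).1
        have hs2 := P.Emono hs1.le
        obtain ⟨k, hk1, hk2, hk3⟩ := k3 l (s + E s - (t + 1)) a u b (by omega) ha hb' hau hub hu huY
        obtain ⟨a', u', b', ha', hb'', hau', hub', hu'⟩ := H.paid s hs k (by omega) (by omega)
        exact hu' (hk3 a' u' b' ha' hb'' hau' hub')
    · have htP : t + 1 ∉ Pd := fun h => by have := (H.Pdb _ h).1; omega
      refine ⟨Y, insert (t + 1) Pd, g1, g2, ⟨max L (h (t + 1)), ?_⟩, ?_, ?_, ?_⟩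
      · intro n hn
        rw [k3 n (le_trans (le_max_right _ _) hn)]
        exact hL n (le_trans (le_max_left _ _) hn)
      · intro j
        have hcn := H.cn j
        unfold credit at *
        rw [Finset.filter_insert]
        split_ifs with hj
        · rw [Finset.sum_insert (by simp [htP])]
          have := k2 j
          omega
        · have := k1 j (by omega)
          omega
      · intro s hs
        rcases Finset.mem_insert.1 hs with rfl | hs
        · exact ⟨by omega, hb⟩
        · have := H.Pdb s hs
          exact ⟨by omega, this.2⟩
      · intro s hs l hl1 hl2
        rcases Finset.mem_insert.1 hs with rfl | hs
        · obtain ⟨a, u, b, ha, hb', hau, hub, hu⟩ := k4 l (by omega) (by omega)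
          have e : t + 1 + E (t + 1) - (t + 1) = E (t + 1) := by omega
          rw [e]
          exact ⟨a, u, b, ha, hb', hau, hub, by rw [k3 l (by omega)]; exact hu⟩
        · obtain ⟨a, u, b, ha, hb', hau, hub, hu⟩ := H.paid s hs l hl1 hl2
          have hs1 := (H.Pdb s hs).1
          have hs2 := P.hmono hs1.le
          exact ⟨a, u, b, ha, hb', hau, hub, by rw [k3 l (by omega)]; exact hu⟩
  · obtain ⟨Y, g1, g2, g3, g4⟩ := good_frame (F := fun j => Fd (t + 1) (t + 1 + j)) (P.h1 (t + 1)) (S (t + 1)) _ (by rw [H.W0]) (P.good t hb) hch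
    refine ⟨Y, Pd, g1, g2, ⟨max L (h (t + 1)), ?_⟩, ?_, ?_, ?_⟩
    · intro n hn
      rw [g4 n (le_trans (le_max_right _ _) hn)]
      exact hL n (le_trans (le_max_left _ _) hn)
    · intro j; exact (g3 j).trans (H.cn j)
    · intro s hs
      have := H.Pdb s hs
      exact ⟨by omega, this.2⟩
    · intro s hs l hl1 hl2
      obtain ⟨a, u, b, ha, hb', hau, hub, hu⟩ := H.paid s hs l hl1 hl2
      have hs1 := (H.Pdb s hs).1
      have hs2 := P.hmono hs1.le
      exact ⟨a, u, b, ha, hb', hau, hub, by rw [g4 l (by omega)]; exact hu⟩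

theorem back_step {h E : ℕ → ℕ} {bad : ℕ → Prop} {Fd : ℕ → ℕ → Finset ℤ} {S : ℕ → Finset ℤ}
    (P : Play h E bad Fd S) (t : ℕ) {W : ℕ → Finset ℤ} {Pd : Finset ℕ}
    (H : St h E bad Fd S (t + 1) W Pd) : ∃ W' Pd', St h E bad Fd S t W' Pd' := by
  obtain ⟨Y, Pd2, g1, g2, ⟨L, hL⟩, g4, g5, g6⟩ := frame_step P t H
  obtain ⟨Z, hZ0, hZs⟩ : ∃ Z : ℕ → Finset ℤ, Z 0 = S t ∧ ∀ i, Z (i + 1) = Y i :=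
    ⟨fun i => Nat.casesOn i (S t) Y, rfl, fun _ => rfl⟩
  have hPT : ∀ e l a, PT W e l a → PT Z (e + 1) (l + 1) a := by
    rintro e l a ⟨p, hp, hpl, hpW⟩
    have h0 : p 0 ∈ Nx (S t) := by
      have := hpW 0 (by omega)
      rw [H.W0] at this
      exact (Finset.mem_sdiff.1 (P.Ssub t this)).1
    have : ∃ y ∈ S t, p 0 = y ∨ p 0 = y + 1 := by
      rw [mem_Nx] at h0
      rcases h0 with h | h
      · exact ⟨_, h, Or.inl rfl⟩
      · exact ⟨_, h, Or.inr (by ring)⟩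
    obtain ⟨y, hy, hpy⟩ := this
    refine ⟨fun i => Nat.casesOn i y p, ?_, hpl, ?_⟩
    · intro i
      cases i with
      | zero => exact hpy
      | succ n => exact hp n
    · intro n hn
      cases n with
      | zero => rw [hZ0]; exact hy
      | succ n => rw [hZs]; exact g1 n (hpW n (by omega))
  refine ⟨Z, Pd2, hZ0, ⟨L + 1, ?_⟩, ?_, g5, ?_⟩
  · intro n hn
    obtain ⟨n', rfl⟩ : ∃ n', n = n' + 1 := ⟨n - 1, by omega⟩
    rw [hZs]; exact hL _ (by omega)
  · intro j
    cases j with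
    | zero => rw [cnt_zero]; omega
    | succ j =>
      have h1 := peel (Y := Y) (F1 := fun j => Fd t (t + j)) (F2 := fun j => Fd (t + 1) (t + j)) hZs
        (by rw [hZ0]; exact g2) (by
          intro L
          refine le_trans ?_ (P.Fstep t (t + L))
          rw [Finset.sum_range_add]
          exact Nat.le_add_left _ _) j
      have h2 := g4 j
      have e : (fun j => Fd (t + 1) (t + 1 + j)) = fun i => Fd (t + 1) (t + (i + 1)) := by
        funext i; congr 1; omega
      rw [e] at h2
      have e2 : t + (j + 1) = t + 1 + j := by omega
      rw [e2]
      omega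
  · intro s hs l hl1 hl2
    have hs1 := (g5 s hs).1
    obtain ⟨l', rfl⟩ : ∃ l', l = l' + 1 := ⟨l - 1, by have := P.h1 s; omega⟩
    obtain ⟨a, u, b, ha, hb', hau, hub, hu⟩ := g6 s hs l' (by omega) (by omega)
    have e : s + E s - t = (s + E s - (t + 1)) + 1 := by omega
    rw [e]
    exact ⟨a, u, b, hPT _ _ _ ha, hPT _ _ _ hb', hau, hub, by rw [hZs]; exact hu⟩

theorem St_zero_false {h E : ℕ → ℕ} {bad : ℕ → Prop} {Fd : ℕ → ℕ → Finset ℤ} {S : ℕ → Finset ℤ}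
    (P : Play h E bad Fd S) {W : ℕ → Finset ℤ} {Pd : Finset ℕ}
    (H : St h E bad Fd S 0 W Pd) : False := by
  classical
  obtain ⟨L, hL⟩ := H.fin
  have hex : ∃ y, W y = ∅ := ⟨L, hL L le_rfl⟩
  set y := Nat.find hex with hy
  have hy0 : W y = ∅ := Nat.find_spec hex
  have hylt : ∀ i < y, (W i).Nonempty := fun i hi => Finset.nonempty_iff_ne_empty.2 (Nat.find_min hex hi)
  have hEpos : ∀ s, 0 < E s := fun s => by have := P.h1 s; have := P.hE s; omega
  set U := Pd.biUnion (fun s => Finset.Ico (s + h s) (s + E s)) with hU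
  have hgap : ∀ i ∈ U, i < y ∧ ∃ a u b, a ∈ W i ∧ b ∈ W i ∧ u ∉ W i ∧ a < u ∧ u < b := by
    intro i hi
    rw [hU, Finset.mem_biUnion] at hi
    obtain ⟨s, hs, his⟩ := hi
    rw [Finset.mem_Ico] at his
    obtain ⟨a, u, b, ⟨p, hp, hpa, hpW⟩, ⟨q, hq, hqa, hqW⟩, hau, hub, hu⟩ := H.paid s hs i (by omega) (by omega)
    constructor
    · by_contra hlt
      have := hpW y (by omega)
      rw [hy0] at this
      simp at this
    · exact ⟨a, u, b, hpa ▸ hpW i (by omega), hqa ▸ hqW i (by omega), hu, hau, hub⟩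
  have hsum : ∑ s ∈ Pd, h s ^ 2 ≤ U.card := by
    apply grouping h E hEpos _ Pd rfl
    intro Q hQ s hs hsQ
    exact P.cond s Q (fun s' hs' => ⟨(hsQ s' hs').1, (hsQ s' hs').2, (H.Pdb s' (hQ hs')).2⟩)
  have hcred : credit h Pd (0 + y) ≤ ∑ s ∈ Pd, h s ^ 2 :=
    Finset.sum_le_sum_of_subset (Finset.filter_subset _ _)
  have hcn := H.cn y
  have key : ∀ j ≤ y, 1 + j + (U ∩ Finset.range j).card ≤ (W j).card + cnt W (fun j => Fd 0 (0 + j)) j := by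
    intro j
    induction j with
    | zero => intro _; rw [H.W0, P.S0]; simp
    | succ n ih =>
      intro hn
      have ih := ih (by omega)
      have h1 : Nx (W n) ⊆ W (n + 1) ∪ bd W (fun j => Fd 0 (0 + j)) n := by
        intro x hx
        rw [Finset.mem_union, mem_bd, P.F0]
        rw [mem_Nx] at hx
        simp only [Finset.notMem_empty, not_false_eq_true, and_true]
        tauto
      have h2 := (Finset.card_le_card h1).trans (Finset.card_union_le _ _)
      rw [cnt_succ]
      have h3 : U ∩ Finset.range (n + 1) ⊆ if n ∈ U then insert n (U ∩ Finset.range n) else U ∩ Finset.range n := by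
        intro x hx
        rw [Finset.mem_inter, Finset.mem_range] at hx
        by_cases hxn : x = n
        · subst hxn; rw [if_pos hx.1]; exact Finset.mem_insert_self _ _
        · have : x ∈ U ∩ Finset.range n := Finset.mem_inter.2 ⟨hx.1, Finset.mem_range.2 (by omega)⟩
          split_ifs
          · exact Finset.mem_insert_of_mem this
          · exact this
      have h4 := Finset.card_le_card h3
      by_cases hnU : n ∈ U
      · rw [if_pos hnU] at h4
        obtain ⟨-, a, u, b, ha, hb, hu, h5, h6⟩ := hgap n hnU
        have := card_Nx_gap ha hb hu h5 h6
        have := Finset.card_insert_le n (U ∩ Finset.range n)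
        omega
      · rw [if_neg hnU] at h4
        have := card_Nx (hylt n (by omega))
        omega
  have hk := key y le_rfl
  have hUy : U ∩ Finset.range y = U := by
    rw [Finset.inter_eq_left]
    intro i hi
    exact Finset.mem_range.2 (hgap i hi).1
  rw [hUy, hy0, Finset.card_empty] at hk
  omega

theorem Play.nonempty {h E : ℕ → ℕ} {bad : ℕ → Prop} {Fd : ℕ → ℕ → Finset ℤ} {S : ℕ → Finset ℤ}
    (P : Play h E bad Fd S) (T : ℕ) : (S T).Nonempty := by
  rw [Finset.nonempty_iff_ne_empty]
  intro hT
  have : ∀ d ≤ T, ∃ W Pd, St h E bad Fd S (T - d) W Pd := by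
    intro d
    induction d with
    | zero =>
      intro _
      refine ⟨fun _ => ∅, ∅, hT.symm, ⟨0, fun _ _ => rfl⟩, ?_, by simp, by simp⟩
      intro j
      have : cnt (fun _ => ∅) (fun j => Fd (T - 0) (T - 0 + j)) j = 0 := by simp [cnt, bd, Nx_empty]
      omega
    | succ d ih =>
      intro hd
      obtain ⟨W, Pd, H⟩ := ih (by omega)
      have e : T - d = (T - (d + 1)) + 1 := by omega
      rw [e] at H
      exact back_step P _ H
  obtain ⟨W, Pd, H⟩ := this T le_rfl
  rw [Nat.sub_self] at H
  exact St_zero_false P H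

end EP

namespace EP

theorem sel_good (A : Finset ℤ) (F : ℕ → Finset ℤ) (h t : ℕ) (hh : 1 ≤ h) (hA : ∀ a ∈ A, 0 ≤ a ∧ a ≤ t) :
    ∃ S ⊆ A, (∀ a ∈ A, a ∈ S ∨ ∃ l ∈ S, ∃ r ∈ S, l ≤ a ∧ a ≤ r ∧ r < l + h ∧
      ∀ j, 1 ≤ j → j ≤ h → ∀ x, l ≤ x → x ≤ r + j → x ∉ F j) ∧
      S.card ≤ 2 * h * (∑ j ∈ Finset.Icc 1 h, (F j).card) + 2 * (t / h + 1) := by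
  have hpos : (0 : ℤ) < h := by exact_mod_cast hh
  have hdiv : ∀ x : ℤ, (x / h) * h ≤ x ∧ x < (x / h) * h + h := by
    intro x
    have h1 := Int.mul_ediv_add_emod x h
    have h2 := Int.emod_nonneg x hpos.ne'
    have h3 := Int.emod_lt_of_pos x hpos
    constructor <;> nlinarith
  obtain ⟨U, hU⟩ : ∃ U : Finset ℤ, ∀ a, a ∈ U ↔ a ∈ A ∧ ∃ j ∈ Finset.Icc 1 h, ∃ x ∈ F j,
      (a / h) * h ≤ x ∧ x < (a / h) * h + 2 * h := by
    classical
    exact ⟨A.filter (fun a => ∃ j ∈ Finset.Icc 1 h, ∃ x ∈ F j,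
      (a / h) * h ≤ x ∧ x < (a / h) * h + 2 * h), fun a => by simp only [Finset.mem_filter]⟩
  set Mi := A.filter (fun a => ∀ b ∈ A, b / (h : ℤ) = a / h → a ≤ b) with hMi
  set Ma := A.filter (fun a => ∀ b ∈ A, b / (h : ℤ) = a / h → b ≤ a) with hMa
  have hbox : ∀ B : Finset ℤ, B ⊆ A → (∀ a ∈ B, ∀ b ∈ B, a / (h : ℤ) = b / h → a = b) → B.card ≤ t / h + 1 := by
    intro B hB hinj
    have : B.card ≤ (Finset.range (t / h + 1)).card := by
      apply Finset.card_le_card_of_injOn (fun a => (a / (h : ℤ)).toNat)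
      · intro a ha
        have h1 := hA a (hB ha)
        simp only [Finset.coe_range, Set.mem_Iio]
        have h2 : a / (h : ℤ) ≤ (t : ℤ) / h := Int.ediv_le_ediv hpos h1.2
        have h3 : ((t / h : ℕ) : ℤ) = (t : ℤ) / h := by push_cast; rfl
        have h4 := Int.ediv_nonneg h1.1 hpos.le
        have h5 : (0:ℤ) ≤ (t : ℤ) / h := h4.trans h2
        generalize a / (h : ℤ) = u at *
        generalize t / h = w at *
        omega
      · intro a ha b hb hab
        have h1 := Int.ediv_nonneg (hA a (hB ha)).1 hpos.le
        have h2 := Int.ediv_nonneg (hA b (hB hb)).1 hpos.le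
        dsimp only at hab
        exact hinj a ha b hb (by omega)
    simpa using this
  refine ⟨U ∪ (Mi ∪ Ma), ?_, ?_, ?_⟩
  · exact Finset.union_subset (fun a ha => ((hU a).1 ha).1)
      (Finset.union_subset (Finset.filter_subset _ _) (Finset.filter_subset _ _))
  · intro a ha
    by_cases haU : a ∈ U
    · left; exact Finset.mem_union_left _ haU
    right
    set B := A.filter (fun b => b / (h : ℤ) = a / h) with hB
    have hne : B.Nonempty := ⟨a, by simp [hB, ha]⟩
    have haB : a ∈ B := by simp [hB, ha]
    have hl := B.min'_mem hne
    have hr := B.max'_mem hne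
    have hla := B.min'_le a haB
    have har := B.le_max' a haB
    have hl2 : B.min' hne ∈ Mi := by
      have hl' := Finset.mem_filter.1 hl
      refine Finset.mem_filter.2 ⟨hl'.1, fun b hb hbe => ?_⟩
      exact B.min'_le b (Finset.mem_filter.2 ⟨hb, hbe.trans hl'.2⟩)
    have hr2 : B.max' hne ∈ Ma := by
      have hr' := Finset.mem_filter.1 hr
      refine Finset.mem_filter.2 ⟨hr'.1, fun b hb hbe => ?_⟩
      exact B.le_max' b (Finset.mem_filter.2 ⟨hb, hbe.trans hr'.2⟩)
    have hld := (Finset.mem_filter.1 hl).2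
    have hrd := (Finset.mem_filter.1 hr).2
    have hl3 := hdiv (B.min' hne)
    have hr3 := hdiv (B.max' hne)
    rw [hld] at hl3
    rw [hrd] at hr3
    refine ⟨_, Finset.mem_union_right _ (Finset.mem_union_left _ hl2), _,
      Finset.mem_union_right _ (Finset.mem_union_right _ hr2), hla, har, by omega, ?_⟩
    intro j h1 h2 x hx1 hx2 hxF
    apply haU
    refine (hU a).2 ⟨ha, j, Finset.mem_Icc.2 ⟨h1, h2⟩, x, hxF, by omega, by omega⟩
  · have hUc : U.card ≤ 2 * h * (∑ j ∈ Finset.Icc 1 h, (F j).card) := by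
      have hs : U ⊆ (Finset.Icc 1 h).biUnion (fun j => (F j).biUnion (fun x =>
          Finset.Ico ((x / h) * h - h) ((x / h) * h + h))) := by
        intro a ha
        obtain ⟨haA, j, hj, x, hx, hx1, hx2⟩ := (hU a).1 ha
        rw [Finset.mem_biUnion]
        refine ⟨j, hj, ?_⟩
        rw [Finset.mem_biUnion]
        refine ⟨x, hx, ?_⟩
        have h1 := hdiv a
        have h2 := hdiv x
        have h3 : a / h ≤ x / h := by
          by_contra hlt
          push Not at hlt
          have : (x / h + 1) * h ≤ (a / h) * h := mul_le_mul_of_nonneg_right hlt hpos.le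
          nlinarith
        have h4 : x / h ≤ a / h + 1 := by
          by_contra hlt
          push Not at hlt
          have : (a / h + 1 + 1) * h ≤ (x / h) * h := mul_le_mul_of_nonneg_right hlt hpos.le
          nlinarith
        have h5 : (a / h) * h ≤ (x / h) * h := mul_le_mul_of_nonneg_right h3 hpos.le
        have h6 : (x / h) * h ≤ (a / h + 1) * h := mul_le_mul_of_nonneg_right h4 hpos.le
        rw [Finset.mem_Ico]
        constructor <;> nlinarith
      refine (Finset.card_le_card hs).trans (Finset.card_biUnion_le.trans ?_)
      rw [Finset.mul_sum]
      apply Finset.sum_le_sum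
      intro j _
      rw [Nat.mul_comm]
      apply Finset.card_biUnion_le_card_mul
      intro x _
      rw [Int.card_Ico]
      omega
    have h1 := hbox Mi (Finset.filter_subset _ _) (by
      intro a ha b hb hab
      have ha := Finset.mem_filter.1 ha
      have hb := Finset.mem_filter.1 hb
      exact le_antisymm (ha.2 b hb.1 hab.symm) (hb.2 a ha.1 hab))
    have h2 := hbox Ma (Finset.filter_subset _ _) (by
      intro a ha b hb hab
      have ha := Finset.mem_filter.1 ha
      have hb := Finset.mem_filter.1 hb
      exact le_antisymm (hb.2 a ha.1 hab) (ha.2 b hb.1 hab.symm))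
    have h3 := Finset.card_union_le U (Mi ∪ Ma)
    have h4 := Finset.card_union_le Mi Ma
    omega

theorem rch_path {F : ℕ → Finset ℤ} {B : Finset ℤ} (j : ℕ) : ∀ x ∈ rch F B j,
    ∃ p, IsPath p ∧ p j = x ∧ p 0 ∈ B ∧ ∀ i, 1 ≤ i → i ≤ j → p i ∉ F i := by
  induction j with
  | zero => 
    intro x hx
    exact ⟨fun _ => x, fun i => Or.inl rfl, rfl, hx, fun i h1 h2 => by omega⟩
  | succ n ih =>
    intro x hx
    rw [rch, Finset.mem_sdiff, mem_Nx] at hx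
    obtain ⟨hx1, hx2⟩ := hx
    have : ∃ y ∈ rch F B n, x = y ∨ x = y + 1 := by
      rcases hx1 with h | h
      · exact ⟨x, h, Or.inl rfl⟩
      · exact ⟨x - 1, h, Or.inr (by ring)⟩
    obtain ⟨y, hy, hxy⟩ := this
    obtain ⟨p, hp, hpn, hp0, hpW⟩ := ih y hy
    obtain ⟨q, hq, hqe, hqx⟩ := path_extend hp n x (by rw [hpn]; exact hxy)
    refine ⟨q, hq, hqx, by rw [hqe 0 (by omega)]; exact hp0, ?_⟩
    intro i h1 h2
    by_cases h : i ≤ n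
    · rw [hqe i h]; exact hpW i h1 h
    · have : i = n + 1 := by omega
      subst this; rw [hqx]; exact hx2

theorem path_rch {F : ℕ → Finset ℤ} {B : Finset ℤ} {p : ℕ → ℤ} (hp : IsPath p) (j : ℕ)
    (h0 : p 0 ∈ B) (h : ∀ i, 1 ≤ i → i ≤ j → p i ∉ F i) : p j ∈ rch F B j := by
  induction j with
  | zero => exact h0
  | succ n ih =>
    rw [rch, Finset.mem_sdiff, mem_Nx]
    have := ih (fun i h1 h2 => h i h1 (by omega))
    refine ⟨?_, h _ (by omega) le_rfl⟩
    rcases hp n with e | e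
    · left; rwa [e]
    · right; rw [e]; simpa using this

theorem crossing {p q : ℕ → ℤ} (hp : IsPath p) (hq : IsPath q) (j : ℕ) (h0 : q 0 < p 0) (hj : p j ≤ q j) :
    ∃ i ≤ j, q i = p i := by
  induction j with
  | zero => omega
  | succ n ih =>
    by_cases h : p n ≤ q n
    · obtain ⟨i, hi, he⟩ := ih h
      exact ⟨i, by omega, he⟩
    · refine ⟨n + 1, le_rfl, ?_⟩
      have := hp n
      have := hq n
      omega

theorem splice {p q : ℕ → ℤ} (hp : IsPath p) (hq : IsPath q) (i : ℕ) (h : q i = p i) :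
    IsPath (fun n => if n ≤ i then q n else p n) := by
  intro n
  dsimp only
  by_cases h1 : n + 1 ≤ i
  · rw [if_pos h1, if_pos (by omega)]; exact hq n
  · rw [if_neg h1]
    split_ifs with h2
    · have : n = i := by omega
      subst this; rw [h]; exact hp n
    · exact hp n

theorem mult_two (C X : Finset ℤ) (f : ℤ → Finset ℤ)
    (hf : ∀ a ∈ C, ∀ b ∈ C, ∀ c ∈ C, a < b → b < c → Disjoint (f a) (f c)) :
    ∑ c ∈ C, (f c ∩ X).card ≤ 2 * X.card := by
  classical
  have h1 : ∀ c ∈ C, (f c ∩ X).card = ∑ x ∈ X, if x ∈ f c then 1 else 0 := by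
    intro c _
    rw [← Finset.card_filter, Finset.filter_mem_eq_inter, Finset.inter_comm]
  rw [Finset.sum_congr rfl h1, Finset.sum_comm, Nat.mul_comm, ← smul_eq_mul]
  apply Finset.sum_le_card_nsmul
  intro x _
  rw [← Finset.card_filter]
  set D := C.filter (fun c => x ∈ f c) with hD
  rcases D.eq_empty_or_nonempty with h | hne
  · rw [h]; simp
  · have : D ⊆ {D.min' hne, D.max' hne} := by
      intro b hb
      rw [Finset.mem_insert, Finset.mem_singleton]
      by_contra hcon
      push Not at hcon
      have ha := Finset.mem_filter.1 (D.min'_mem hne)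
      have hc := Finset.mem_filter.1 (D.max'_mem hne)
      have h1 := D.min'_le b hb
      have h2 := D.le_max' b hb
      have := hf _ ha.1 b (Finset.mem_filter.1 hb).1 _ hc.1 (by omega) (by omega)
      exact Finset.disjoint_left.1 this ha.2 hc.2
    exact (Finset.card_le_card this).trans Finset.card_le_two

theorem sel_cover (A : Finset ℤ) (F : ℕ → Finset ℤ) (h t : ℕ) (hA : ∀ a ∈ A, 0 ≤ a ∧ a ≤ t) :
    ∃ C ⊆ A, rch F A h ⊆ rch F C h ∧
      C.card * (h + 1) ≤ 2 * (t + h + 1) + 2 * (∑ j ∈ Finset.Icc 1 h, (F j).card) := by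
  classical
  set Cs := A.powerset.filter (fun C => rch F A h ⊆ rch F C h) with hCs
  have hne : Cs.Nonempty := ⟨A, by simp [hCs]⟩
  obtain ⟨C, hC, hmin⟩ := Finset.exists_min_image Cs Finset.card hne
  rw [hCs, Finset.mem_filter, Finset.mem_powerset] at hC
  refine ⟨C, hC.1, hC.2, ?_⟩
  -- private paths
  have hpriv : ∀ c ∈ C, ∃ p, IsPath p ∧ p 0 = c ∧ (∀ i, 1 ≤ i → i ≤ h → p i ∉ F i) ∧
      p h ∉ rch F (C.erase c) h := by
    intro c hc
    have : ¬ rch F A h ⊆ rch F (C.erase c) h := by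
      intro hsub
      have := hmin (C.erase c) (by
        rw [hCs, Finset.mem_filter, Finset.mem_powerset]
        exact ⟨(Finset.erase_subset _ _).trans hC.1, hsub⟩)
      have := Finset.card_erase_lt_of_mem hc
      omega
    obtain ⟨v, hv1, hv2⟩ := Finset.not_subset.1 this
    obtain ⟨p, hp, hph, hp0, hpF⟩ := rch_path h v (hC.2 hv1)
    refine ⟨p, hp, ?_, hpF, by rw [hph]; exact hv2⟩
    by_contra hne
    apply hv2
    rw [← hph]
    exact path_rch hp h (Finset.mem_erase.2 ⟨hne, hp0⟩) hpF
  choose! P hP hP0 hPF hPv using hpriv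
  have hsplice : ∀ b ∈ C, ∀ a ∈ C, a ≠ b → ∀ q, IsPath q → q 0 = a → ∀ j ≤ h,
      (∀ i, 1 ≤ i → i ≤ j → q i ∉ F i) → q j ≠ P b j := by
    intro b hb a ha hab q hq hq0 j hj hqF he
    apply hPv b hb
    have hs := splice (hP b hb) hq j he
    have := path_rch (F := F) (B := C.erase b) hs h (by
      simp only [Nat.zero_le, if_true, hq0]; exact Finset.mem_erase.2 ⟨hab, ha⟩) (by
      intro i h1 h2
      split_ifs with h3
      · exact hqF i h1 h3
      · exact hPF b hb i h1 h2)
    split_ifs at this with h3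
    · have : j = h := by omega
      subst this
      rwa [he] at this
    · exact this
  have hleft : ∀ a ∈ C, ∀ b ∈ C, a < b → ∀ j ≤ h, ∀ x ∈ rch F {a} j, x < P b j := by
    intro a ha b hb hab j hj x hx
    obtain ⟨q, hq, hqx, hq0, hqF⟩ := rch_path j x hx
    rw [Finset.mem_singleton] at hq0
    by_contra hcon
    push Not at hcon
    obtain ⟨i, hi, he⟩ := crossing (hP b hb) hq j (by rw [hq0, hP0 b hb]; exact hab) (by rw [hqx]; exact hcon)
    exact hsplice b hb a ha hab.ne q hq hq0 i (by omega) (fun i' h1 h2 => hqF i' h1 (by omega)) he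
  have hright : ∀ b ∈ C, ∀ c ∈ C, b < c → ∀ j ≤ h, ∀ x ∈ rch F {c} j, P b j < x := by
    intro b hb c hc hbc j hj x hx
    obtain ⟨q, hq, hqx, hq0, hqF⟩ := rch_path j x hx
    rw [Finset.mem_singleton] at hq0
    by_contra hcon
    push Not at hcon
    obtain ⟨i, hi, he⟩ := crossing hq (hP b hb) j (by rw [hq0, hP0 b hb]; exact hbc) (by rw [hqx]; exact hcon)
    exact hsplice b hb c hc hbc.ne' q hq hq0 i (by omega) (fun i' h1 h2 => hqF i' h1 (by omega)) he.symm
  have hdisj : ∀ j ≤ h, ∀ a ∈ C, ∀ b ∈ C, ∀ c ∈ C, a < b → b < c → 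
      Disjoint (Nx (rch F {a} j)) (Nx (rch F {c} j)) := by
    intro j hj a ha b hb c hc hab hbc
    rw [Finset.disjoint_left]
    intro x hx1 hx2
    rw [mem_Nx] at hx1 hx2
    have h1 : x ≤ P b j := by
      rcases hx1 with h | h <;> have := hleft a ha b hb hab j hj _ h <;> omega
    have h2 : P b j < x := by
      rcases hx2 with h | h <;> have := hright b hb c hc hbc j hj _ h <;> omega
    omega
  have key : ∀ j ≤ h, C.card * (j + 1) ≤ ∑ c ∈ C, (rch F {c} j).card + 2 * ∑ i ∈ Finset.Icc 1 j, (F i).card := by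
    intro j
    induction j with
    | zero => intro _; simp [rch]
    | succ n ih =>
      intro hn
      have ih := ih (by omega)
      have h1 := mult_two C (F (n + 1)) (fun c => Nx (rch F {c} n)) (hdisj n (by omega))
      have h2 : ∑ c ∈ C, ((rch F {c} n).card + 1) ≤ 
          ∑ c ∈ C, ((rch F {c} (n + 1)).card + (Nx (rch F {c} n) ∩ F (n + 1)).card) := by
        apply Finset.sum_le_sum
        intro c hc
        rw [rch, Finset.card_sdiff_add_card_inter]
        apply card_Nx
        refine ⟨P c n, path_rch (hP c hc) n (by simp [hP0 c hc]) (fun i h1 h2 => hPF c hc i h1 (by omega))⟩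
      rw [Finset.sum_add_distrib, Finset.sum_add_distrib, Finset.sum_const, smul_eq_mul, mul_one] at h2
      rw [Finset.sum_Icc_succ_top (by omega)]
      nlinarith
  have hk := key h le_rfl
  have hX : ∑ c ∈ C, (rch F {c} h).card ≤ 2 * (t + h + 1) := by
    have h1 := mult_two C (Finset.Icc (0 : ℤ) ((t : ℤ) + h)) (fun c => Nx (rch F {c} h)) (hdisj h le_rfl)
    rw [Int.card_Icc] at h1
    refine le_trans (Finset.sum_le_sum ?_) (h1.trans (by omega))
    intro c hc
    apply Finset.card_le_card
    intro x hx
    rw [Finset.mem_inter, mem_Nx, Finset.mem_Icc]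
    obtain ⟨q, hq, hqx, hq0, -⟩ := rch_path h x hx
    rw [Finset.mem_singleton] at hq0
    have := hq.mono h
    have := hA c (hC.1 hc)
    exact ⟨Or.inl hx, by omega, by omega⟩
  omega

theorem sel_bad (A : Finset ℤ) (F : ℕ → Finset ℤ) (h t E K : ℕ) (hA : ∀ a ∈ A, 0 ≤ a ∧ a ≤ t) :
    ∃ S ⊆ A, greedy E F id K A ⊆ S ∧ greedy E F (fun x => -x) K A ⊆ S ∧ rch F A h ⊆ rch F S h ∧
      S.card ≤ (2 * (t + h + 1) + 2 * (∑ j ∈ Finset.Icc 1 h, (F j).card)) / (h + 1) + 2 * (K + 1) := by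
  obtain ⟨C, hC1, hC2, hC3⟩ := sel_cover A F h t hA
  refine ⟨C ∪ (greedy E F id K A ∪ greedy E F (fun x => -x) K A), ?_, ?_, ?_, ?_, ?_⟩
  · exact Finset.union_subset hC1 (Finset.union_subset greedy_sub greedy_sub)
  · exact Finset.subset_union_left.trans Finset.subset_union_right
  · exact Finset.subset_union_right.trans Finset.subset_union_right
  · exact hC2.trans (rch_mono Finset.subset_union_left h)
  · have h1 := greedy_card (E := E) (F := F) (key := id) Function.injective_id (K := K) (A := A)
    have h2 := greedy_card (E := E) (F := F) (key := fun x => -x) neg_injective (K := K) (A := A)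
    have h3 := Finset.card_union_le C (greedy E F id K A ∪ greedy E F (fun x => -x) K A)
    have h4 := Finset.card_union_le (greedy E F id K A) (greedy E F (fun x => -x) K A)
    have h5 : C.card ≤ (2 * (t + h + 1) + 2 * (∑ j ∈ Finset.Icc 1 h, (F j).card)) / (h + 1) :=
      (Nat.le_div_iff_mul_le (by omega)).2 hC3
    omega

end EP

namespace EP

def hf (t : ℕ) : ℕ := Nat.findGreatest (fun k => k ^ 7 ≤ t + 1) (t + 1)

theorem hf_le (t : ℕ) : (hf t) ^ 7 ≤ t + 1 :=
  Nat.findGreatest_spec (P := fun k => k ^ 7 ≤ t + 1) (m := 0) (by omega) (by simp)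

theorem le_hf {k t : ℕ} (h : k ^ 7 ≤ t + 1) : k ≤ hf t :=
  Nat.le_findGreatest ((Nat.le_self_pow (by norm_num) k).trans h) h

theorem hf_one (t : ℕ) : 1 ≤ hf t := le_hf (by simp)

theorem hf_lt (t : ℕ) : t + 1 < (hf t + 1) ^ 7 := by
  by_contra h
  have := le_hf (not_lt.1 h)
  omega

theorem hf_mono : Monotone hf := fun s t h => le_hf ((hf_le s).trans (by omega))

theorem hf_lt' (t : ℕ) : t + 1 ≤ 128 * (hf t) ^ 7 := by
  have h1 := hf_lt t
  have h2 : (hf t + 1) ^ 7 ≤ (2 * hf t) ^ 7 := Nat.pow_le_pow_left (by have := hf_one t; omega) 7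
  rw [mul_pow] at h2
  norm_num at h2
  omega

theorem hf_window {s t : ℕ} (h : t < s + hf s ^ 5) : hf t ≤ hf s + 1 := by
  by_contra hc
  push Not at hc
  have h1 : (hf s + 2) ^ 7 ≤ hf t ^ 7 := Nat.pow_le_pow_left hc 7
  have h2 := hf_le t
  have h3 := hf_lt s
  have h4 : (hf s + 1) ^ 7 + hf s ^ 5 ≤ (hf s + 2) ^ 7 := by
    have a : (hf s + 1) ^ 7 + (hf s + 1) ^ 6 ≤ (hf s + 2) ^ 7 := by
      have : (hf s + 1) ^ 6 ≤ (hf s + 2) ^ 6 := Nat.pow_le_pow_left (by omega) 6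
      calc (hf s + 1) ^ 7 + (hf s + 1) ^ 6 = (hf s + 1) ^ 6 * (hf s + 2) := by ring
        _ ≤ (hf s + 2) ^ 6 * (hf s + 2) := Nat.mul_le_mul_right _ this
        _ = _ := by ring
    have b : hf s ^ 5 ≤ (hf s + 1) ^ 6 :=
      (Nat.pow_le_pow_left (by omega) 5).trans (Nat.pow_le_pow_right (by omega) (by norm_num))
    omega
  omega

/-- number of near-future deletions -/
def Nf (Fd : ℕ → ℕ → Finset ℤ) (t : ℕ) : ℕ := ∑ j ∈ Finset.Icc 1 (hf t), (Fd t (t + j)).card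

def isBad (Fd : ℕ → ℕ → Finset ℤ) (t : ℕ) : Prop := 2064 * hf t ^ 5 ≤ Nf Fd t

theorem total_le {Fd : ℕ → ℕ → Finset ℤ} (F0 : ∀ n, Fd 0 n = ∅)
    (Fstep : ∀ t L, ∑ n ∈ Finset.range L, (Fd (t+1) n \ Fd t n).card ≤ 1) (t L : ℕ) :
    ∑ n ∈ Finset.range L, (Fd t n).card ≤ t := by
  induction t with
  | zero => simp [F0]
  | succ t ih =>
    have h1 : ∑ n ∈ Finset.range L, (Fd (t+1) n).card ≤
        ∑ n ∈ Finset.range L, ((Fd (t+1) n \ Fd t n).card + (Fd t n).card) :=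
      Finset.sum_le_sum (fun n _ => Finset.card_le_card_sdiff_add_card)
    rw [Finset.sum_add_distrib] at h1
    have := Fstep t L
    omega

theorem shift_sum (g : ℕ → ℕ) (Q : Finset ℕ) (j L : ℕ) (hQ : ∀ t ∈ Q, t + j < L) :
    ∑ t ∈ Q, g (t + j) ≤ ∑ n ∈ Finset.range L, g n := by
  rw [← Finset.sum_image (s := Q) (g := fun t => t + j) (f := g) (by intro a _ b _ h; simpa using h)]
  apply Finset.sum_le_sum_of_subset
  intro n hn
  obtain ⟨t, ht, rfl⟩ := Finset.mem_image.1 hn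
  exact Finset.mem_range.2 (hQ t ht)

theorem Nf_le {Fd : ℕ → ℕ → Finset ℤ} (F0 : ∀ n, Fd 0 n = ∅)
    (Fstep : ∀ t L, ∑ n ∈ Finset.range L, (Fd (t+1) n \ Fd t n).card ≤ 1) (t : ℕ) : Nf Fd t ≤ t := by
  unfold Nf
  have := shift_sum (fun n => (Fd t n).card) (Finset.Icc 1 (hf t)) t (t + hf t + 1) (by
    intro j hj; have := Finset.mem_Icc.1 hj; omega)
  have h2 := total_le F0 Fstep t (t + hf t + 1)
  simp only [Nat.add_comm _ t] at this
  omega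

theorem window_sum {Fd : ℕ → ℕ → Finset ℤ} (F0 : ∀ n, Fd 0 n = ∅)
    (Fmono : ∀ t n, Fd t n ⊆ Fd (t+1) n)
    (Fstep : ∀ t L, ∑ n ∈ Finset.range L, (Fd (t+1) n \ Fd t n).card ≤ 1)
    (T H : ℕ) (Q : Finset ℕ) (hQ : ∀ t ∈ Q, t < T ∧ hf t ≤ H) :
    ∑ t ∈ Q, Nf Fd t ≤ H * T := by
  have hm : ∀ n, Monotone (fun t => Fd t n) := fun n => monotone_nat_of_le_succ (fun t => Fmono t n)
  have h1 : ∀ t ∈ Q, Nf Fd t ≤ ∑ j ∈ Finset.Icc 1 H, (Fd T (t + j)).card := by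
    intro t ht
    obtain ⟨a, b⟩ := hQ t ht
    unfold Nf
    refine (Finset.sum_le_sum (fun j _ => Finset.card_le_card (hm (t + j) a.le))).trans ?_
    exact Finset.sum_le_sum_of_subset (f := fun j => (Fd T (t + j)).card) (Finset.Icc_subset_Icc_right b)
  refine (Finset.sum_le_sum h1).trans ?_
  rw [Finset.sum_comm]
  have h2 : ∀ j ∈ Finset.Icc 1 H, ∑ t ∈ Q, (Fd T (t + j)).card ≤ T := by
    intro j hj
    refine (shift_sum (fun n => (Fd T n).card) Q j (T + H + 1) ?_).trans (total_le F0 Fstep T _)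
    intro t ht
    have := hQ t ht
    have := Finset.mem_Icc.1 hj
    omega
  have := Finset.sum_le_card_nsmul _ _ _ h2
  simpa using this

theorem cond_holds {Fd : ℕ → ℕ → Finset ℤ} (F0 : ∀ n, Fd 0 n = ∅)
    (Fmono : ∀ t n, Fd t n ⊆ Fd (t+1) n)
    (Fstep : ∀ t L, ∑ n ∈ Finset.range L, (Fd (t+1) n \ Fd t n).card ≤ 1)
    (s : ℕ) (Q : Finset ℕ) (hQ : ∀ s' ∈ Q, s ≤ s' ∧ s' < s + hf s ^ 5 ∧ isBad Fd s') :
    ∑ s' ∈ Q, hf s' ^ 2 + hf s ≤ hf s ^ 5 := by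
  have hw := window_sum F0 Fmono Fstep (s + hf s ^ 5) (hf s + 1) Q (fun t ht =>
    ⟨(hQ t ht).2.1, hf_window (hQ t ht).2.1⟩)
  have h1 := hf_one s
  have h2 := hf_lt' s
  set h := hf s with hh
  have h3 : Q.card * (2064 * h ^ 5) ≤ ∑ t ∈ Q, Nf Fd t := by
    rw [← smul_eq_mul]
    apply Finset.card_nsmul_le_sum
    intro t ht
    refine le_trans ?_ (hQ t ht).2.2
    have : h ^ 5 ≤ hf t ^ 5 := Nat.pow_le_pow_left (hf_mono (hQ t ht).1) 5
    omega
  have h4 : ∑ t ∈ Q, hf t ^ 2 ≤ Q.card * (4 * h ^ 2) := by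
    rw [← smul_eq_mul]
    apply Finset.sum_le_card_nsmul
    intro t ht
    have a := hf_window (hQ t ht).2.1
    have : hf t ≤ 2 * h := by omega
    calc hf t ^ 2 ≤ (2 * h) ^ 2 := Nat.pow_le_pow_left this 2
      _ = _ := by ring
  have h57 : h ^ 5 ≤ h ^ 7 := Nat.pow_le_pow_right h1 (by norm_num)
  have h5 : Q.card * (2064 * h ^ 5) ≤ (2 * h) * (129 * h ^ 7) :=
    h3.trans (hw.trans (Nat.mul_le_mul (by omega) (by omega)))
  have h6 : Q.card * 2064 ≤ 258 * h ^ 3 := by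
    have : (Q.card * 2064) * h ^ 5 ≤ (258 * h ^ 3) * h ^ 5 := by
      calc _ = Q.card * (2064 * h ^ 5) := by ring
        _ ≤ _ := h5
        _ = _ := by ring
    exact Nat.le_of_mul_le_mul_right this (by positivity)
  rcases Nat.lt_or_ge h 2 with hlt | hge
  · have e : h = 1 := by omega
    rw [e] at h6 h4 ⊢
    have : Q.card = 0 := by omega
    rw [this] at h4
    omega
  · have h7 : (Q.card * (4 * h ^ 2)) * 516 ≤ 258 * h ^ 5 := by
      calc _ = (Q.card * 2064) * h ^ 2 := by ring
        _ ≤ (258 * h ^ 3) * h ^ 2 := Nat.mul_le_mul_right _ h6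
        _ = _ := by ring
    have h8 : 2 * h ≤ h ^ 5 := by
      calc 2 * h ≤ h * h := Nat.mul_le_mul_right _ hge
        _ = h ^ 2 := by ring
        _ ≤ h ^ 5 := Nat.pow_le_pow_right h1 (by norm_num)
    omega

theorem size_good (h t N : ℕ) (h1 : 1 ≤ h) (h2 : t + 1 ≤ 128 * h ^ 7) (hN : N < 2064 * h ^ 5) :
    2 * h * N + 2 * (t / h + 1) ≤ 4386 * h ^ 6 := by
  have a : 2 * h * N ≤ 4128 * h ^ 6 := by
    calc 2 * h * N ≤ 2 * h * (2064 * h ^ 5) := Nat.mul_le_mul_left _ hN.le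
      _ = _ := by ring
  have b : t / h ≤ 128 * h ^ 6 := by
    apply Nat.div_le_of_le_mul
    calc t ≤ 128 * h ^ 7 := by omega
      _ = _ := by ring
  have c : 1 ≤ h ^ 6 := Nat.one_le_pow _ _ h1
  omega

theorem size_bad (h t N : ℕ) (h1 : 1 ≤ h) (h2 : t + 1 ≤ 128 * h ^ 7) (hN : N ≤ t) :
    (2 * (t + h + 1) + 2 * N) / (h + 1) + 2 * (2 * h ^ 5 + 1) ≤ 4386 * h ^ 6 := by
  have b : (2 * (t + h + 1) + 2 * N) / (h + 1) ≤ 514 * h ^ 6 := by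
    apply Nat.div_le_of_le_mul
    have : h ≤ h ^ 7 := Nat.le_self_pow (by norm_num) h
    calc 2 * (t + h + 1) + 2 * N ≤ 514 * h ^ 7 := by omega
      _ ≤ 514 * h ^ 7 + 514 * h ^ 6 := Nat.le_add_right _ _
      _ = _ := by ring
  have c : 1 ≤ h ^ 6 := Nat.one_le_pow _ _ h1
  have d : h ^ 5 ≤ h ^ 6 := Nat.pow_le_pow_right h1 (by norm_num)
  omega

theorem size_real (t : ℕ) (ht : 1 ≤ t) :
    4386 * hf t ^ 6 ≤ ⌈(8772 : ℝ) * (t : ℝ) ^ ((6 : ℝ) / 7)⌉₊ := by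
  have h1 : ((hf t : ℝ)) ^ 7 ≤ 2 * t := by
    have := hf_le t
    have h2 : hf t ^ 7 ≤ 2 * t := by omega
    exact_mod_cast h2
  have h2 : ((hf t : ℝ)) ^ 6 ≤ 2 * (t : ℝ) ^ ((6 : ℝ) / 7) := by
    have e : ((hf t : ℝ)) ^ 6 = ((hf t : ℝ) ^ 7) ^ ((6 : ℝ) / 7) := by
      rw [← Real.rpow_natCast, ← Real.rpow_natCast, ← Real.rpow_mul (by positivity)]
      norm_num
    rw [e]
    refine (Real.rpow_le_rpow (by positivity) h1 (by norm_num)).trans ?_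
    rw [Real.mul_rpow (by norm_num) (by positivity)]
    apply mul_le_mul_of_nonneg_right _ (by positivity)
    calc (2 : ℝ) ^ ((6 : ℝ) / 7) ≤ 2 ^ (1 : ℝ) := Real.rpow_le_rpow_of_exponent_le (by norm_num) (by norm_num)
      _ = 2 := Real.rpow_one 2
  have h3 : ((4386 * hf t ^ 6 : ℕ) : ℝ) ≤ (8772 : ℝ) * (t : ℝ) ^ ((6 : ℝ) / 7) := by
    push_cast
    linarith
  exact_mod_cast h3.trans (Nat.le_ceil _)

end EP

namespace EP

open Classical in
noncomputable def lev (X : Set ZEighth) (n : ℕ) : Finset ℤ :=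
  (Finset.Icc 0 (n : ℤ)).filter (fun x => ∃ hx : 0 ≤ x ∧ x ≤ (n : ℤ), (⟨(x, (n : ℤ)), hx⟩ : ZEighth) ∈ X)

theorem mem_lev {X : Set ZEighth} {n : ℕ} {x : ℤ} :
    x ∈ lev X n ↔ ∃ hx : 0 ≤ x ∧ x ≤ (n : ℤ), (⟨(x, (n : ℤ)), hx⟩ : ZEighth) ∈ X := by
  classical
  unfold lev
  rw [Finset.mem_filter, Finset.mem_Icc]
  exact ⟨fun h => h.2, fun h => ⟨h.1, h⟩⟩

def SelP (G : ℕ → Finset ℤ) (t : ℕ) (A S : Finset ℤ) : Prop :=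
  S ⊆ A ∧ S.card ≤ 4386 * hf t ^ 6 ∧
  (¬ (2064 * hf t ^ 5 ≤ ∑ j ∈ Finset.Icc 1 (hf t), (G (t + j)).card) →
    ∀ a ∈ A, a ∈ S ∨ ∃ l ∈ S, ∃ r ∈ S, l ≤ a ∧ a ≤ r ∧ r < l + hf t ∧
      ∀ j, 1 ≤ j → j ≤ hf t → ∀ x, l ≤ x → x ≤ r + j → x ∉ G (t + j)) ∧
  ((2064 * hf t ^ 5 ≤ ∑ j ∈ Finset.Icc 1 (hf t), (G (t + j)).card) →
    greedy (hf t ^ 5) (fun j => G (t + j)) id (2 * hf t ^ 5) A ⊆ S ∧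
    greedy (hf t ^ 5) (fun j => G (t + j)) (fun x => -x) (2 * hf t ^ 5) A ⊆ S ∧
    rch (fun j => G (t + j)) A (hf t) ⊆ rch (fun j => G (t + j)) S (hf t))

theorem SelP_exists (G : ℕ → Finset ℤ) (t : ℕ) (A : Finset ℤ) (hA : ∀ a ∈ A, 0 ≤ a ∧ a ≤ t)
    (hN : ∑ j ∈ Finset.Icc 1 (hf t), (G (t + j)).card ≤ t) : ∃ S, SelP G t A S := by
  by_cases hb : 2064 * hf t ^ 5 ≤ ∑ j ∈ Finset.Icc 1 (hf t), (G (t + j)).card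
  · obtain ⟨S, h1, h2, h3, h4, h5⟩ := sel_bad A (fun j => G (t + j)) (hf t) t (hf t ^ 5) (2 * hf t ^ 5) hA
    exact ⟨S, h1, h5.trans (size_bad _ _ _ (hf_one t) (hf_lt' t) hN), fun h => absurd hb h,
      fun _ => ⟨h2, h3, h4⟩⟩
  · obtain ⟨S, h1, h2, h3⟩ := sel_good A (fun j => G (t + j)) (hf t) t (hf_one t) hA
    exact ⟨S, h1, h3.trans (size_good _ _ _ (hf_one t) (hf_lt' t) (not_le.1 hb)), fun _ => h2,
      fun h => absurd h hb⟩

open Classical in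
noncomputable def pick (G : ℕ → Finset ℤ) (t : ℕ) (A : Finset ℤ) : Finset ℤ :=
  if h : ∃ S, SelP G t A S then Classical.choose h else ∅

theorem pick_spec {G : ℕ → Finset ℤ} {t : ℕ} {A : Finset ℤ} (h : ∃ S, SelP G t A S) :
    SelP G t A (pick G t A) := by
  unfold pick
  rw [dif_pos h]
  exact Classical.choose_spec h

theorem pick_sub (G : ℕ → Finset ℤ) (t : ℕ) (A : Finset ℤ) :
    pick G t A ⊆ A ∧ (pick G t A).card ≤ 4386 * hf t ^ 6 := by
  by_cases h : ∃ S, SelP G t A S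
  · exact ⟨(pick_spec h).1, (pick_spec h).2.1⟩
  · unfold pick
    rw [dif_neg h]
    simp

noncomputable def Sf (F : ℕ → Set ZEighth) : ℕ → Finset ℤ
  | 0 => {0}
  | t + 1 => pick (lev (F (t + 1))) (t + 1) (Nx (Sf F t) \ lev (F (t + 1)) (t + 1))

theorem Sf_congr {F F' : ℕ → Set ZEighth} (t : ℕ) (h : ∀ i, 1 ≤ i → i ≤ t → F i = F' i) :
    Sf F t = Sf F' t := by
  induction t with
  | zero => rfl
  | succ t ih =>
    rw [Sf, Sf, ih (fun i h1 h2 => h i h1 (by omega)), h (t + 1) (by omega) le_rfl]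

theorem Sf_bd (F : ℕ → Set ZEighth) (t : ℕ) : ∀ x ∈ Sf F t, 0 ≤ x ∧ x ≤ (t : ℤ) := by
  induction t with
  | zero => intro x hx; simp [Sf] at hx; simp [hx]
  | succ t ih =>
    intro x hx
    rw [Sf] at hx
    have := (pick_sub _ _ _).1 hx
    rw [Finset.mem_sdiff, mem_Nx] at this
    push_cast
    rcases this.1 with h | h <;> have := ih _ h <;> omega

def vt (n : ℕ) (S : Finset ℤ) : Set ZEighth := {v | v.val.2 = (n : ℤ) ∧ v.val.1 ∈ S}

theorem vt_encard (n : ℕ) (S : Finset ℤ) : (vt n S).encard ≤ (S.card : ℕ∞) := by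
  rw [← Set.encard_coe_eq_coe_finsetCard]
  have hinj : Set.InjOn (fun v : ZEighth => v.val.1) (vt n S) := by
    intro a ha b hb hab
    apply Subtype.ext
    exact Prod.ext hab (ha.1.trans hb.1.symm)
  rw [← hinj.encard_image]
  apply Set.encard_le_encard
  rintro x ⟨v, hv, rfl⟩
  exact hv.2

noncomputable def tau (l : List (Set ZEighth)) : Set ZEighth :=
  vt l.length (Sf (fun i => l.getD (i - 1) ∅) l.length)

theorem tau_eq (F : ℕ → Set ZEighth) (t : ℕ) :
    tau ((List.range (t + 1)).map fun i => F (i + 1)) = vt (t + 1) (Sf F (t + 1)) := by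
  unfold tau
  simp only [List.length_map, List.length_range]
  congr 1
  apply Sf_congr
  intro i h1 h2
  rw [List.getD_eq_getElem _ _ (by simp; omega)]
  simp
  congr 1
  omega

abbrev O0 : Set ZEighth := {⟨(0, 0), ⟨le_refl 0, le_refl 0⟩⟩}

theorem occ_mem (F : ℕ → Set ZEighth) (t : ℕ) (v : ZEighth) :
    v ∈ occSets tau O0 F t ↔ ∃ n ≤ t, v ∈ vt n (Sf F n) := by
  induction t with
  | zero =>
    rw [occSets]
    constructor
    · intro h
      rw [Set.mem_singleton_iff] at h
      subst h
      exact ⟨0, le_rfl, by simp [vt, Sf]⟩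
    · rintro ⟨n, hn, h⟩
      obtain rfl : n = 0 := by omega
      simp only [vt, Sf, Set.mem_ofPred_eq, Finset.mem_singleton] at h
      rw [Set.mem_singleton_iff]
      apply Subtype.ext
      exact Prod.ext h.2 h.1
  | succ t ih =>
    rw [occSets, tau_eq, Set.mem_union, ih]
    constructor
    · rintro (⟨n, hn, h⟩ | h)
      · exact ⟨n, by omega, h⟩
      · exact ⟨t + 1, le_rfl, h⟩
    · rintro ⟨n, hn, h⟩
      rcases Nat.lt_or_ge t n with h1 | h1
      · right
        obtain rfl : n = t + 1 := by omega
        exact h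
      · exact Or.inl ⟨n, h1, h⟩

theorem spreader_legal (F : ℕ → Set ZEighth) :
    SpreaderLegal adjEighth (fun t => (⌈(8772 : ℝ) * (t : ℝ) ^ ((6 : ℝ) / 7)⌉₊ : ℕ∞)) F (occSets tau O0 F) := by
  intro t
  have hsub : occSets tau O0 F (t + 1) \ occSets tau O0 F t ⊆ vt (t + 1) (Sf F (t + 1)) := by
    rw [occSets, tau_eq]
    intro v hv
    exact hv.1.resolve_left hv.2
  have hp := pick_sub (lev (F (t + 1))) (t + 1) (Nx (Sf F t) \ lev (F (t + 1)) (t + 1))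
  refine ⟨?_, ?_, ?_⟩
  · rw [occSets]; exact Set.subset_union_left
  · refine (Set.encard_le_encard hsub).trans ((vt_encard _ _).trans ?_)
    have : (Sf F (t + 1)).card ≤ ⌈(8772 : ℝ) * ((t + 1 : ℕ) : ℝ) ^ ((6 : ℝ) / 7)⌉₊ :=
      hp.2.trans (size_real (t + 1) (by omega))
    exact Nat.cast_le.2 this
  · intro v hv
    obtain ⟨h1, h2⟩ := hsub hv
    have h3 := hp.1 h2
    rw [Finset.mem_sdiff, mem_Nx, mem_lev] at h3
    obtain ⟨h3, h4⟩ := h3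
    obtain ⟨⟨x, y⟩, hxy⟩ := v
    simp only at h1 h2 h3 h4 hxy
    subst h1
    refine ⟨fun h => h4 ⟨hxy, h⟩, ?_⟩
    rcases h3 with h | h
    · refine ⟨⟨(x, (t : ℤ)), Sf_bd F t _ h⟩, (occ_mem _ _ _).2 ⟨t, le_rfl, rfl, h⟩, ?_⟩
      left; simp
    · refine ⟨⟨(x - 1, (t : ℤ)), Sf_bd F t _ h⟩, (occ_mem _ _ _).2 ⟨t, le_rfl, rfl, h⟩, ?_⟩
      left; simp

theorem budget_one (t : ℕ) : budget 1 (t + 1) = 1 := by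
  unfold budget
  simp

theorem play_of_legal {F B : ℕ → Set ZEighth} (hF : ContainerSeqLegal 1 F B) :
    Play hf (fun t => hf t ^ 5) (isBad (fun t => lev (F t))) (fun t => lev (F t)) (Sf F) := by
  have F0 : ∀ n, lev (F 0) n = ∅ := by
    intro n
    rw [hF.1]
    ext x
    simp [mem_lev]
  have Fmono : ∀ t n, lev (F t) n ⊆ lev (F (t+1)) n := by
    intro t n x hx
    obtain ⟨h1, h2⟩ := mem_lev.1 hx
    exact mem_lev.2 ⟨h1, (hF.2 t).1 h2⟩
  have Fstep : ∀ t L, ∑ n ∈ Finset.range L, (lev (F (t+1)) n \ lev (F t) n).card ≤ 1 := by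
    intro t L
    rw [← Finset.card_sigma, Finset.card_le_one]
    have h1 := (hF.2 t).2.1
    rw [budget_one, Nat.cast_one, Set.encard_le_one_iff] at h1
    rintro ⟨n, x⟩ ha ⟨m, y⟩ hb
    rw [Finset.mem_sigma, Finset.mem_sdiff, mem_lev, mem_lev] at ha hb
    obtain ⟨-, ⟨hx, hx1⟩, hx2⟩ := ha
    obtain ⟨-, ⟨hy, hy1⟩, hy2⟩ := hb
    have := h1 _ _ ⟨hx1, fun h => hx2 ⟨hx, h⟩⟩ ⟨hy1, fun h => hy2 ⟨hy, h⟩⟩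
    rw [Subtype.mk.injEq, Prod.mk.injEq] at this
    obtain ⟨e1, e2⟩ := this
    simp only at e1 e2
    have e3 : n = m := by exact_mod_cast e2
    subst e1 e3
    rfl
  have hsel : ∀ t, SelP (lev (F (t + 1))) (t + 1) (Nx (Sf F t) \ lev (F (t + 1)) (t + 1)) (Sf F (t + 1)) := by
    intro t
    rw [Sf]
    apply pick_spec
    apply SelP_exists
    · intro a ha
      rw [Finset.mem_sdiff, mem_Nx] at ha
      push_cast
      rcases ha.1 with h | h <;> have := Sf_bd F t _ h <;> omega
    · exact Nf_le (Fd := fun t => lev (F t)) F0 Fstep (t + 1)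
  exact {
    h1 := hf_one
    hmono := hf_mono
    Emono := fun s t h => Nat.pow_le_pow_left (hf_mono h) 5
    hE := fun t => Nat.le_self_pow (by norm_num) _
    cond := fun s Q hQ => cond_holds (Fd := fun t => lev (F t)) F0 Fmono Fstep s Q hQ
    S0 := rfl
    F0 := F0
    Fstep := Fstep
    Ssub := fun t => (hsel t).1
    good := fun t => (hsel t).2.2.1
    badL := fun t hb => ((hsel t).2.2.2 hb).1
    badR := fun t hb => ((hsel t).2.2.2 hb).2.1
    badC := fun t hb => ((hsel t).2.2.2 hb).2.2 }

theorem never_stops {F B : ℕ → Set ZEighth} (hF : ContainerSeqLegal 1 F B) (T : ℕ) :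
    occSets tau O0 F (T + 1) ≠ occSets tau O0 F T := by
  obtain ⟨x, hx⟩ := (play_of_legal hF).nonempty (T + 1)
  intro he
  have h1 : (⟨(x, ((T + 1 : ℕ) : ℤ)), Sf_bd F (T + 1) x hx⟩ : ZEighth) ∈ occSets tau O0 F (T + 1) :=
    (occ_mem _ _ _).2 ⟨T + 1, le_rfl, rfl, hx⟩
  rw [he, occ_mem] at h1
  obtain ⟨n, hn, h2, -⟩ := h1
  simp only at h2
  omega

section fixpoint
variable {V : Type*}

theorem delSets_congr (σ : List (Set V) → Set V) {B B' : ℕ → Set V} (t : ℕ) (h : ∀ i < t, B i = B' i) :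
    delSets σ B t = delSets σ B' t := by
  induction t with
  | zero => rfl
  | succ t ih =>
    rw [delSets, delSets, ih (fun i hi => h i (by omega))]
    congr 2
    apply List.map_congr_left
    intro i hi
    exact h i (List.mem_range.1 hi)

theorem occSets_congr (τ : List (Set V) → Set V) (B₀ : Set V) {F F' : ℕ → Set V} (t : ℕ) (h : ∀ i ≤ t, F i = F' i) :
    occSets τ B₀ F t = occSets τ B₀ F' t := by
  induction t with
  | zero => rfl
  | succ t ih =>
    rw [occSets, occSets, ih (fun i hi => h i (by omega))]
    congr 2
    apply List.map_congr_left
    intro i hi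
    have := List.mem_range.1 hi
    exact h _ (by omega)

def iter (σ τ : List (Set V) → Set V) (B₀ : Set V) : ℕ → ℕ → Set V
  | 0 => fun _ => B₀
  | k + 1 => occSets τ B₀ (delSets σ (iter σ τ B₀ k))

theorem step_congr (σ τ : List (Set V) → Set V) (B₀ : Set V) {B B' : ℕ → Set V} (t : ℕ)
    (h : ∀ i < t, B i = B' i) : occSets τ B₀ (delSets σ B) t = occSets τ B₀ (delSets σ B') t :=
  occSets_congr τ B₀ t (fun i hi => delSets_congr σ i (fun j hj => h j (by omega)))

theorem iter_stable (σ τ : List (Set V) → Set V) (B₀ : Set V) (k : ℕ) :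
    ∀ t ≤ k, iter σ τ B₀ (k + 1) t = iter σ τ B₀ k t := by
  induction k with
  | zero =>
    intro t ht
    obtain rfl : t = 0 := by omega
    rfl
  | succ k ih =>
    intro t ht
    rw [iter, iter]
    exact step_congr σ τ B₀ t (fun i hi => ih i (by omega))

theorem exists_fix (σ τ : List (Set V) → Set V) (B₀ : Set V) :
    ∃ B : ℕ → Set V, occSets τ B₀ (delSets σ B) = B := by
  refine ⟨fun t => iter σ τ B₀ t t, ?_⟩
  have hst : ∀ t d, iter σ τ B₀ (t + d) t = iter σ τ B₀ t t := by
    intro t d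
    induction d with
    | zero => rfl
    | succ d ih => rw [← ih]; exact iter_stable σ τ B₀ (t + d) t (by omega)
  funext t
  have h1 := step_congr σ τ B₀ (B := fun t => iter σ τ B₀ t t) (B' := iter σ τ B₀ t) t (by
    intro i hi
    have := hst i (t - i)
    rw [Nat.add_sub_cancel' hi.le] at this
    exact this.symm)
  rw [h1]
  exact hst t 1

end fixpoint

end EP

/-- **Theorem.** There is `C > 0` such that Spreader wins the containment game on the
eighth plane against Container of strength `q = 1`, with initial occupied set
`{(0, 0)}` and spreading function `g(t) = ⌈C·t^{6/7}⌉`; in particular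
`1 ∉ q(Z_eighth, t ↦ ⌈C·t^{6/7}⌉)`. -/
theorem spreader_wins_eighth_sublinear :
    ∃ C : ℝ, 0 < C ∧
      SpreaderWins adjEighth 1 (fun t => (⌈C * (t : ℝ) ^ ((6 : ℝ) / 7)⌉₊ : ℕ∞))
        ({⟨(0, 0), ⟨le_refl 0, le_refl 0⟩⟩} : Set ZEighth) ∧
      (1 : ℝ) ∉ qSet adjEighth (fun t => (⌈C * (t : ℝ) ^ ((6 : ℝ) / 7)⌉₊ : ℕ∞)) := by
  refine ⟨8772, by norm_num, ⟨EP.tau, fun F hF => ⟨EP.spreader_legal F, fun T =>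
    ⟨T + 1, by omega, EP.never_stops hF T⟩⟩⟩, ?_⟩
  rintro ⟨-, h⟩
  obtain ⟨σ, hσ⟩ := h EP.O0 (Set.finite_singleton _)
  obtain ⟨B, hB⟩ := EP.exists_fix σ EP.tau EP.O0
  have hl := EP.spreader_legal (delSets σ B)
  rw [hB] at hl
  obtain ⟨h1, -, T, hT⟩ := hσ B (by rw [← hB]; rfl) hl
  have hc : ContainerSeqLegal 1 (delSets σ B) B := by
    refine ⟨rfl, fun t => ?_⟩
    have hsub : delSets σ B (t + 1) \ delSets σ B t ⊆ σ ((List.range (t + 1)).map B) := by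
      rw [delSets]
      intro v hv
      exact hv.1.resolve_left hv.2
    refine ⟨by rw [delSets]; exact Set.subset_union_left, (Set.encard_le_encard hsub).trans (h1 t).2, ?_⟩
    apply Set.eq_empty_of_subset_empty
    rw [← (h1 t).1]
    exact Set.inter_subset_inter_left _ hsub
  have := EP.never_stops hc T
  rw [hB] at this
  exact this (hT (T + 1) (by omega))
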